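/- arXiv:1109.1617 — 2 statements merged into one kernel-verified Lean document; each statement's English description precedes it below -/
import Mathlib

section
/- Let ψ : ℝ → ℝ be a real-valued Schwartz function whose Fourier transform ψ̂(ξ) = ∫_ℝ e^{−iξx} ψ(x) dx vanishes outside { ξ : 2π/3 ≤ |ξ| ≤ 8π/3 }, let Ψ(y,θ) = ∫_ℝ (y−x)₊^{θ−1/2} ψ(x) dx, let (ε_{j,k})_{(j,k)∈ℤ²} be real numbers with |ε_{j,k}| ≤ C₀ √( log(2+|j|) log(2+|k|) ) for some C₀ < ∞, and define B̃₂(t,θ) = Σ_{j=1}^{∞} 2^{−jθ} Σ_{k∈ℤ} ε_{j,k} Ψ(2^j t − k, θ). Then for every nonnegative integer n, every arbitrarily small ε > 0 and all reals M, a, b with M > 0 and 0 < a < b < 1, there exists a constant C < ∞, depending only on n, ε, M, a, b and the sequence (ε_{j,k}), such that for every θ ∈ [a,b] and all t₁, t₂ ∈ [−M,M]: |∂_θⁿ B̃₂(t₁,θ) − ∂_θⁿ B̃₂(t₂,θ)| ≤ C |t₁ − t₂|^{θ−ε}. -/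
open MeasureTheory Set Real

noncomputable section

/-- `u₊^a`: equals `u^a` if `u > 0` and `0` otherwise. -/
def posRPow (u a : ℝ) : ℝ := if 0 < u then u ^ a else 0

/-- The Fourier transform `ψ̂(ξ) = ∫ e^{−iξx} ψ(x) dx` of a real-valued function. -/
def fourierT (ψ : ℝ → ℝ) (ξ : ℝ) : ℂ :=
  ∫ x : ℝ, Complex.exp (-(Complex.I * ξ * x)) * (ψ x : ℂ)

/-- The fractional primitive `Ψ(y,θ) = ∫ (y−x)₊^{θ−1/2} ψ(x) dx`. -/
def PsiFrac (ψ : ℝ → ℝ) (y θ : ℝ) : ℝ :=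
  ∫ x : ℝ, posRPow (y - x) (θ - 1/2) * ψ x

/-- The high-frequency part
`B̃₂(t,θ) = Σ_{j=1}^∞ 2^{−jθ} Σ_{k∈ℤ} ε_{j,k} Ψ(2^j t − k, θ)`. -/
def Btwo (ψ : ℝ → ℝ) (e : ℤ × ℤ → ℝ) (t θ : ℝ) : ℝ :=
  ∑' j : ℕ, (2:ℝ) ^ (-((j : ℝ) + 1) * θ)
    * ∑' k : ℤ, e ((j : ℤ) + 1, k) * PsiFrac ψ ((2:ℝ) ^ ((j : ℤ) + 1) * t - (k : ℝ)) θ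


/-- complex kernel -/
def kern (z : ℂ) (u : ℝ) : ℂ := if 0 < u then (u : ℂ) ^ (z - 1/2) else 0

/-- weight -/
def wt (v : ℝ) : ℝ := 1 + (Ioo (0:ℝ) 1).indicator (fun v => v ^ (-(1/2) : ℝ)) v

lemma one_le_wt (v : ℝ) : 1 ≤ wt v := by
  unfold wt
  have : 0 ≤ (Ioo (0:ℝ) 1).indicator (fun v => v ^ (-(1/2) : ℝ)) v :=
    indicator_nonneg (fun x hx => rpow_nonneg hx.1.le _) _
  linarith

lemma kern_bound (z : ℂ) (h0 : 0 < z.re) (h1 : z.re < 1) (u : ℝ) :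
    ‖kern z u‖ ≤ wt u * (1 + |u|) := by
  have hw := one_le_wt u
  have hu := abs_nonneg u
  unfold kern
  split_ifs with h
  · rw [Complex.norm_cpow_eq_rpow_re_of_pos h]
    have hre : (z - 1/2).re = z.re - 1/2 := by simp
    rw [hre]
    by_cases hu1 : u < 1
    · have : u ^ (z.re - 1/2) ≤ wt u := by
        unfold wt
        rw [indicator_of_mem (show u ∈ Ioo (0:ℝ) 1 from ⟨h, hu1⟩)]
        have : u ^ (z.re - 1/2) ≤ u ^ (-(1/2) : ℝ) :=
          rpow_le_rpow_of_exponent_ge h hu1.le (by linarith)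
        linarith
      nlinarith
    · push Not at hu1
      have : u ^ (z.re - 1/2) ≤ u ^ (1:ℝ) :=
          rpow_le_rpow_of_exponent_le hu1 (by linarith)
      rw [rpow_one] at this
      rw [abs_of_pos h]
      nlinarith
  · simp; positivity

lemma cpow_taylor (s : ℂ) (hs : ‖s‖ ≤ 2) (h0 : -(1/2) < s.re) (h1 : s.re < 1/2) (v : ℝ)
    (hv : |v| ≤ 1/2) : ‖((1 - v : ℝ) : ℂ) ^ s - 1 + s * v‖ ≤ 48 * v ^ 2 := by
  have hd : ∀ (r : ℂ) (x : ℝ), |x| ≤ 1/2 →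
      HasDerivAt (fun x : ℝ => ((1 - x : ℝ) : ℂ) ^ r) (-(r * ((1 - x : ℝ) : ℂ) ^ (r - 1))) x := by
    intro r x hx
    have hx' := abs_le.1 hx
    have hc : HasDerivAt (fun w : ℂ => (1 - w) ^ r) (r * (1 - (x:ℂ)) ^ (r - 1) * (-1)) (x : ℂ) := by
      have h := ((hasDerivAt_id (x:ℂ)).const_sub 1)
      refine h.cpow_const ?_
      left; simp; linarith
    have := hc.comp_ofReal
    convert this using 1
    · funext x; push_cast; rfl
    · push_cast; ring
  have hb : ∀ x : ℝ, |x| ≤ 1/2 → ‖((1 - x : ℝ) : ℂ) ^ (s - 1 - 1)‖ ≤ 8 := by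
    intro x hx
    have hx' := abs_le.1 hx
    rw [Complex.norm_cpow_eq_rpow_re_of_pos (by linarith)]
    have hre : (s - 1 - 1).re = s.re - 2 := by simp; ring
    rw [hre]
    calc (1 - x) ^ (s.re - 2) ≤ (1/2 : ℝ) ^ (s.re - 2) :=
          rpow_le_rpow_of_nonpos (by norm_num) (by linarith) (by linarith)
      _ ≤ (1/2 : ℝ) ^ (-3 : ℝ) :=
          rpow_le_rpow_of_exponent_ge (by norm_num) (by norm_num) (by linarith)
      _ = 8 := by
          rw [show (-3:ℝ) = ((-3:ℤ):ℝ) by norm_num, rpow_intCast]; norm_num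
  have hs1 : ‖s - 1‖ ≤ 3 := by
    calc _ ≤ ‖s‖ + ‖(1:ℂ)‖ := norm_sub_le _ _
      _ ≤ 3 := by rw [norm_one]; linarith
  have habs : ∀ x ∈ uIcc (0:ℝ) v, |x| ≤ |v| := by
    intro x hx
    have := abs_sub_left_of_mem_uIcc hx
    simpa using this
  have key1 : ∀ x ∈ uIcc (0:ℝ) v, ‖-(s * ((1 - x : ℝ) : ℂ) ^ (s - 1)) + s‖ ≤ 48 * |v| := by
    intro x hx
    have hxv := habs x hx
    have := (convex_uIcc (0:ℝ) v).norm_image_sub_le_of_norm_hasDerivWithin_le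
      (f := fun x : ℝ => -(s * ((1 - x : ℝ) : ℂ) ^ (s - 1)) + s)
      (f' := fun x : ℝ => -(s * -((s - 1) * ((1 - x : ℝ) : ℂ) ^ (s - 1 - 1))))
      (C := 48) (x := 0) (y := x) ?_ ?_ left_mem_uIcc hx
    · simp only [sub_zero, Complex.ofReal_one, Complex.one_cpow] at this
      rw [Real.norm_eq_abs] at this
      have h2 : ‖-(s * ((1 - x : ℝ) : ℂ) ^ (s - 1)) + s‖ ≤ 48 * |x| := by
        simpa using this
      linarith
    · intro y hy
      exact ((((hd (s-1) y ((habs y hy).trans hv)).const_mul s).neg).add_const s).hasDerivWithinAt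
    · intro y hy
      have := hb y ((habs y hy).trans hv)
      rw [norm_neg, norm_mul, norm_neg, norm_mul]
      calc _ ≤ 2 * (3 * 8 : ℝ) := by gcongr
        _ = 48 := by norm_num
  have := (convex_uIcc (0:ℝ) v).norm_image_sub_le_of_norm_hasDerivWithin_le
      (f := fun x : ℝ => ((1 - x : ℝ) : ℂ) ^ s - 1 + s * x)
      (f' := fun x : ℝ => -(s * ((1 - x : ℝ) : ℂ) ^ (s - 1)) + s)
      (C := 48 * |v|) (x := 0) (y := v) ?_ key1 left_mem_uIcc right_mem_uIcc
  · simp only [sub_zero, Complex.ofReal_one, Complex.one_cpow, Complex.ofReal_zero, mul_zero,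
      add_zero, sub_self] at this
    rw [Real.norm_eq_abs, mul_assoc, ← sq, sq_abs] at this
    exact this
  · intro y hy
    have h3 : HasDerivAt (fun x : ℝ => s * (x:ℂ)) s y := by
      simpa using (Complex.ofRealCLM.hasDerivAt (x := y)).const_mul s
    exact (((hd s y ((habs y hy).trans hv)).sub_const 1).add h3).hasDerivWithinAt

lemma kern_pointwise (z : ℂ) (h0 : 0 < z.re) (h1 : z.re < 1) (him : |z.im| < 1) (y x : ℝ) :
    ‖kern z (y - x) - (if 1 ≤ y then (y:ℂ) ^ (z - 1/2) - (z - 1/2) * (y:ℂ) ^ (z - 1/2 - 1) * x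
      else 0)‖ ≤ 200 * (1 + |y|) ^ (-(3/2) : ℝ) * (1 + |x|) ^ 4 * wt (y - x) := by
  have hw := one_le_wt (y - x)
  have hxx := abs_nonneg x
  have hyy := abs_nonneg y
  have hs : ‖z - 1/2‖ ≤ 2 := by
    refine (Complex.norm_le_abs_re_add_abs_im _).trans ?_
    have h2 : |(z - 1/2).re| ≤ 1/2 := by
      rw [abs_le]; constructor <;> simp <;> linarith
    have h3 : |(z - 1/2).im| ≤ 1 := by simpa using him.le
    linarith
  have hre : (z - 1/2).re = z.re - 1/2 := by simp
  have hre1 : (z - 1/2 - 1).re = z.re - 3/2 := by simp; ring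
  have hk := kern_bound z h0 h1 (y - x)
  have hu : 1 + |y - x| ≤ (1 + |y|) * (1 + |x|) := by
    have := abs_sub y x
    nlinarith
  -- the inverse weight
  have hinv : ∀ B : ℝ, 0 ≤ B → (1 + |y|) ^ 2 ≤ B → 1 ≤ (1 + |y|) ^ (-(3/2) : ℝ) * B := by
    intro B hB hle
    have hp : (0:ℝ) < 1 + |y| := by linarith
    have h5 : (1 + |y|) ^ (3/2 : ℝ) ≤ B := by
      refine le_trans ?_ hle
      rw [← rpow_natCast]
      exact rpow_le_rpow_of_exponent_le (by linarith) (by norm_num)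
    have h6 : (1 + |y|) ^ (-(3/2) : ℝ) * (1 + |y|) ^ (3/2 : ℝ) = 1 := by
      rw [← rpow_add hp]; norm_num
    have h7 := rpow_nonneg hp.le (-(3/2) : ℝ)
    nlinarith
  have hr0 : 0 ≤ (1 + |y|) ^ (-(3/2) : ℝ) := rpow_nonneg (by linarith) _
  split_ifs with hy
  · have hypos : 0 < y := by linarith
    by_cases hx : |x| ≤ y / 2
    · -- Taylor
      have hyx : 0 < y - x := by have := (abs_le.1 hx).2; linarith
      have hv : |x / y| ≤ 1/2 := by
        rw [abs_div, abs_of_pos hypos, div_le_iff₀ hypos]; linarith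
      have ht := cpow_taylor (z - 1/2) hs (by rw [hre]; linarith) (by rw [hre]; linarith) (x / y) hv
      have hv1 : 0 ≤ 1 - x / y := by have := (abs_le.1 hv).2; linarith
      have e1 : kern z (y - x) - ((y:ℂ) ^ (z - 1/2) - (z - 1/2) * (y:ℂ) ^ (z - 1/2 - 1) * x)
          = (y:ℂ) ^ (z - 1/2) *
            (((1 - x / y : ℝ) : ℂ) ^ (z - 1/2) - 1 + (z - 1/2) * (x / y : ℝ)) := by
        have hy0 : (y:ℂ) ≠ 0 := by exact_mod_cast hypos.ne'
        unfold kern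
        rw [if_pos hyx]
        have : ((y - x : ℝ) : ℂ) = (y:ℂ) * ((1 - x / y : ℝ) : ℂ) := by
          push_cast; field_simp
        rw [this, Complex.mul_cpow_ofReal_nonneg hypos.le hv1, Complex.cpow_sub (z - 1/2) 1 hy0,
          Complex.cpow_one]
        generalize (y:ℂ) ^ (z - 1/2) = Y
        generalize (((1 - x / y : ℝ) : ℂ)) ^ (z - 1/2) = V
        push_cast
        ring
      rw [e1, norm_mul, Complex.norm_cpow_eq_rpow_re_of_pos hypos, hre]
      calc y ^ (z.re - 1/2) * _ ≤ y ^ (1/2 : ℝ) * (48 * (x / y) ^ 2) := by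
            gcongr
            linarith
        _ = 48 * (x ^ 2 * y ^ (-(3/2) : ℝ)) := by
            have : y ^ (-(3/2) : ℝ) = y ^ (1/2 : ℝ) / y ^ 2 := by
              rw [← rpow_natCast, ← rpow_sub hypos]; norm_num
            rw [this]; field_simp
        _ ≤ 48 * ((1 + |x|) ^ 4 * (4 * (1 + |y|) ^ (-(3/2) : ℝ))) := by
            gcongr
            · rw [← sq_abs]
              calc |x| ^ 2 ≤ (1 + |x|) ^ 2 := by gcongr; linarith
                _ ≤ (1 + |x|) ^ 4 := pow_le_pow_right₀ (by linarith) (by norm_num)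
            · rw [abs_of_pos hypos]
              have hy2 : ((1 + y) / 2) ^ (-(3/2) : ℝ) ≤ 4 * (1 + y) ^ (-(3/2) : ℝ) := by
                rw [div_rpow (by linarith) (by norm_num), rpow_neg (by norm_num : (0:ℝ) ≤ 2),
                  div_inv_eq_mul, mul_comm]
                gcongr
                calc (2:ℝ) ^ (3/2 : ℝ) ≤ 2 ^ (2:ℝ) :=
                      rpow_le_rpow_of_exponent_le (by norm_num) (by norm_num)
                  _ = 4 := by norm_num
              refine le_trans ?_ hy2
              exact rpow_le_rpow_of_nonpos (by linarith) (by linarith) (by norm_num)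
        _ = 192 * (1 + |y|) ^ (-(3/2) : ℝ) * (1 + |x|) ^ 4 * 1 := by ring
        _ ≤ _ := by gcongr; norm_num
    · push Not at hx
      rw [abs_of_pos hypos] at *
      have hB := hinv (16 * |x| ^ 2) (by positivity) (by nlinarith)
      have hL : ‖(y:ℂ) ^ (z - 1/2) - (z - 1/2) * (y:ℂ) ^ (z - 1/2 - 1) * x‖
          ≤ 4 * (1 + |x|) ^ 2 := by
        refine (norm_sub_le _ _).trans ?_
        rw [norm_mul, norm_mul, Complex.norm_cpow_eq_rpow_re_of_pos hypos,
          Complex.norm_cpow_eq_rpow_re_of_pos hypos, hre, hre1, Complex.norm_real, Real.norm_eq_abs]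
        have a1 : y ^ (z.re - 1/2) ≤ y ^ (1:ℝ) := rpow_le_rpow_of_exponent_le hy (by linarith)
        have a2 : y ^ (z.re - 3/2) ≤ y ^ (0:ℝ) := rpow_le_rpow_of_exponent_le hy (by linarith)
        rw [rpow_one] at a1
        rw [rpow_zero] at a2
        have a3 : ‖z - 1/2‖ * y ^ (z.re - 3/2) * |x| ≤ 2 * 1 * |x| := by gcongr
        nlinarith
      have hK : ‖kern z (y - x)‖ ≤ 4 * (1 + |x|) ^ 2 * wt (y - x) := by
        refine hk.trans ?_
        rw [mul_comm]
        gcongr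
        nlinarith
      have hT : ‖kern z (y - x) - ((y:ℂ) ^ (z - 1/2) - (z - 1/2) * (y:ℂ) ^ (z - 1/2 - 1) * x)‖
          ≤ 8 * (1 + |x|) ^ 2 * wt (y - x) := by
        refine (norm_sub_le _ _).trans ?_
        have : 4 * (1 + |x|) ^ 2 ≤ 4 * (1 + |x|) ^ 2 * wt (y - x) := by
          apply le_mul_of_one_le_right (by positivity) hw
        linarith
      calc _ ≤ 8 * (1 + |x|) ^ 2 * wt (y - x) * 1 := by rw [mul_one]; exact hT
        _ ≤ 8 * (1 + |x|) ^ 2 * wt (y - x) * ((1 + y) ^ (-(3/2) : ℝ) * (16 * |x| ^ 2)) := by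
            gcongr
        _ ≤ 8 * (1 + |x|) ^ 2 * wt (y - x) * ((1 + y) ^ (-(3/2) : ℝ) * (16 * (1 + |x|) ^ 2)) := by
            gcongr; linarith
        _ = 128 * (1 + y) ^ (-(3/2) : ℝ) * (1 + |x|) ^ 4 * wt (y - x) := by ring
        _ ≤ _ := by gcongr; norm_num
  · push Not at hy
    rw [sub_zero]
    by_cases hyx : 0 < y - x
    · have hyx2 : 1 + |y| ≤ 2 * (1 + |x|) := by
        rcases le_total 0 y with h | h
        · rw [abs_of_nonneg h]; linarith
        · rw [abs_of_nonpos h, abs_of_nonpos (by linarith)]; linarith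
      have hB := hinv (4 * (1 + |x|) ^ 2) (by positivity) (by nlinarith)
      calc _ ≤ wt (y - x) * (2 * (1 + |x|) * (1 + |x|)) * 1 := by
            rw [mul_one]
            refine hk.trans ?_
            gcongr
            nlinarith
        _ ≤ wt (y - x) * (2 * (1 + |x|) * (1 + |x|)) *
             ((1 + |y|) ^ (-(3/2) : ℝ) * (4 * (1 + |x|) ^ 2)) := by gcongr
        _ = 8 * (1 + |y|) ^ (-(3/2) : ℝ) * (1 + |x|) ^ 4 * wt (y - x) := by ring
        _ ≤ _ := by gcongr; norm_num
    · unfold kern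
      rw [if_neg hyx, norm_zero]
      positivity

/-- majorant -/
def maj (y x : ℝ) : ℝ :=
  (1 + |x|) ^ (-2 : ℝ) + (Ioo (0:ℝ) 1).indicator (fun v => v ^ (-(1/2) : ℝ)) (y - x)

lemma int_ind : Integrable ((Ioo (0:ℝ) 1).indicator (fun v => v ^ (-(1/2) : ℝ))) := by
  rw [integrable_indicator_iff measurableSet_Ioo]
  have := (intervalIntegral.intervalIntegrable_rpow' (a := 0) (b := 1) (r := -(1/2)) (by norm_num))
  rw [intervalIntegrable_iff_integrableOn_Ioo_of_le (by norm_num)] at this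
  exact this

lemma int_jap : Integrable (fun x : ℝ => (1 + |x|) ^ (-2 : ℝ)) := by
  have := integrable_one_add_norm (E := ℝ) (μ := volume) (r := 2) (by simp)
  simpa using this

lemma int_maj (y : ℝ) : Integrable (maj y) :=
  int_jap.add (int_ind.comp_sub_left y)

/-- the integral of the majorant -/
def majC : ℝ := (∫ x : ℝ, (1 + |x|) ^ (-2 : ℝ)) +
  ∫ x : ℝ, (Ioo (0:ℝ) 1).indicator (fun v => v ^ (-(1/2) : ℝ)) x

lemma integral_maj (y : ℝ) : ∫ x, maj y x = majC := by
  unfold maj majC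
  rw [integral_add int_jap (int_ind.comp_sub_left y)]
  congr 1
  exact integral_sub_left_eq_self ((Ioo (0:ℝ) 1).indicator (fun v => v ^ (-(1/2) : ℝ))) volume y

lemma majC_nonneg : 0 ≤ majC := by
  rw [← integral_maj 0]
  refine integral_nonneg fun x => ?_
  unfold maj
  have : 0 ≤ (Ioo (0:ℝ) 1).indicator (fun v => v ^ (-(1/2) : ℝ)) (0 - x) :=
    indicator_nonneg (fun x hx => rpow_nonneg hx.1.le _) _
  have := rpow_nonneg (show 0 ≤ 1 + |x| by positivity) (-2 : ℝ)
  simp only [Pi.zero_apply]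
  linarith

lemma wt_le_maj (y x : ℝ) : wt (y - x) * (1 + |x|) ^ (-2 : ℝ) ≤ maj y x := by
  unfold wt maj
  have : 0 ≤ (Ioo (0:ℝ) 1).indicator (fun v => v ^ (-(1/2) : ℝ)) (y - x) :=
    indicator_nonneg (fun x hx => rpow_nonneg hx.1.le _) _
  have h2 : (1 + |x|) ^ (-2 : ℝ) ≤ 1 :=
    rpow_le_one_of_one_le_of_nonpos (by linarith [abs_nonneg x]) (by norm_num)
  nlinarith

/-- complex fractional primitive -/
def Phi (η : ℝ → ℝ) (y : ℝ) (z : ℂ) : ℂ := ∫ x : ℝ, kern z (y - x) * (η x : ℂ)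

lemma kern_measurable (z : ℂ) : Measurable (kern z) := by
  unfold kern
  refine Measurable.ite measurableSet_Ioi ?_ measurable_const
  exact (Complex.measurable_ofReal).pow_const _

lemma pow_jap (η : ℝ → ℝ) (A : ℝ) (hA : ∀ x, |η x| * (1 + |x|) ^ 6 ≤ A) (x : ℝ) :
    |η x| * (1 + |x|) ^ 4 ≤ A * (1 + |x|) ^ (-2 : ℝ) := by
  have hp : 0 < 1 + |x| := by positivity
  have h := mul_le_mul_of_nonneg_right (hA x) (rpow_nonneg hp.le (-2 : ℝ))
  have : (1 + |x|) ^ 6 * (1 + |x|) ^ (-2 : ℝ) = (1 + |x|) ^ 4 := by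
    rw [← rpow_natCast, ← rpow_natCast, ← rpow_add hp]; norm_num
  rwa [mul_assoc, this] at h

lemma Phi_integrable (η : ℝ → ℝ) (hc : Continuous η) (A : ℝ)
    (hA : ∀ x, |η x| * (1 + |x|) ^ 6 ≤ A) (y : ℝ) (z : ℂ) (h0 : 0 < z.re) (h1 : z.re < 1) :
    Integrable (fun x : ℝ => kern z (y - x) * (η x : ℂ)) := by
  refine ((int_maj y).const_mul (A * (1 + |y|))).mono' ?_ (ae_of_all _ fun x => ?_)
  · refine (((kern_measurable z).comp (measurable_const.sub measurable_id)).mul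
      (Complex.measurable_ofReal.comp hc.measurable)).aestronglyMeasurable
  · have hp : 0 < 1 + |x| := by positivity
    have hA0 : 0 ≤ A := le_trans (by positivity) (hA 0)
    have hw := one_le_wt (y - x)
    have hu : 1 + |y - x| ≤ (1 + |y|) * (1 + |x|) := by
      have := abs_sub y x
      nlinarith [abs_nonneg x, abs_nonneg y]
    rw [norm_mul, Complex.norm_real, Real.norm_eq_abs]
    calc ‖kern z (y - x)‖ * |η x| ≤ (wt (y - x) * ((1 + |y|) * (1 + |x|))) * |η x| := by
          gcongr
          exact (kern_bound z h0 h1 _).trans (by gcongr)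
      _ = wt (y - x) * (1 + |y|) * (|η x| * (1 + |x|) ^ 1) := by ring
      _ ≤ wt (y - x) * (1 + |y|) * (|η x| * (1 + |x|) ^ 4) := by
          gcongr
          · linarith [abs_nonneg x]
          · norm_num
      _ ≤ wt (y - x) * (1 + |y|) * (A * (1 + |x|) ^ (-2 : ℝ)) := by
          gcongr ?_ * ?_
          exact pow_jap η A hA x
      _ = A * (1 + |y|) * (wt (y - x) * (1 + |x|) ^ (-2 : ℝ)) := by ring
      _ ≤ _ := by gcongr; exact wt_le_maj y x

lemma eta_int (η : ℝ → ℝ) (hc : Continuous η) (A : ℝ)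
    (hA : ∀ x, |η x| * (1 + |x|) ^ 6 ≤ A) :
    Integrable η ∧ Integrable (fun x => x * η x) := by
  have hb : ∀ x, |η x| ≤ A * (1 + |x|) ^ (-2 : ℝ) := fun x =>
    le_trans (le_mul_of_one_le_right (abs_nonneg _)
      (one_le_pow₀ (by linarith [abs_nonneg x]))) (pow_jap η A hA x)
  have hb2 : ∀ x, |x * η x| ≤ A * (1 + |x|) ^ (-2 : ℝ) := fun x => by
    refine le_trans ?_ (pow_jap η A hA x)
    rw [abs_mul, mul_comm]
    gcongr
    calc |x| ≤ (1 + |x|) ^ 1 := by linarith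
      _ ≤ _ := pow_le_pow_right₀ (by linarith [abs_nonneg x]) (by norm_num)
  exact ⟨(int_jap.const_mul A).mono' hc.aestronglyMeasurable (ae_of_all _ hb),
   (int_jap.const_mul A).mono' (continuous_id.mul hc).aestronglyMeasurable (ae_of_all _ hb2)⟩

lemma Phi_decay (η : ℝ → ℝ) (hc : Continuous η) (A : ℝ)
    (hA : ∀ x, |η x| * (1 + |x|) ^ 6 ≤ A) (hm0 : ∫ x, η x = 0) (hm1 : ∫ x, x * η x = 0)
    (y : ℝ) (z : ℂ) (h0 : 0 < z.re) (h1 : z.re < 1) (him : |z.im| < 1) :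
    ‖Phi η y z‖ ≤ 200 * majC * A * (1 + |y|) ^ (-(3/2) : ℝ) := by
  have hA0 : 0 ≤ A := le_trans (by positivity) (hA 0)
  obtain ⟨i0, i1⟩ := eta_int η hc A hA
  set L : ℝ → ℂ := fun x => if 1 ≤ y then
    (y:ℂ) ^ (z - 1/2) - (z - 1/2) * (y:ℂ) ^ (z - 1/2 - 1) * x else 0 with hL
  have i0c : Integrable (fun x => (η x : ℂ)) := i0.ofReal
  have i1c : Integrable (fun x => ((x * η x : ℝ) : ℂ)) := i1.ofReal
  have hLint : Integrable (fun x => L x * (η x : ℂ)) ∧ ∫ x, L x * (η x : ℂ) = 0 := by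
    by_cases hy : 1 ≤ y
    · have e : (fun x => L x * (η x : ℂ)) = fun x => (y:ℂ) ^ (z - 1/2) * (η x : ℂ) -
          (z - 1/2) * (y:ℂ) ^ (z - 1/2 - 1) * ((x * η x : ℝ) : ℂ) := by
        funext x
        simp only [hL, if_pos hy]
        push_cast
        ring
      rw [e]
      refine ⟨(i0c.const_mul _).sub (i1c.const_mul _), ?_⟩
      rw [integral_sub (i0c.const_mul _) (i1c.const_mul _), integral_const_mul, integral_const_mul,
        integral_complex_ofReal, integral_complex_ofReal, hm0, hm1]
      simp
    · simp [hL, if_neg hy]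
  have hK := Phi_integrable η hc A hA y z h0 h1
  have e : Phi η y z = ∫ x, (kern z (y - x) - L x) * (η x : ℂ) := by
    unfold Phi
    simp_rw [sub_mul]
    rw [integral_sub hK hLint.1, hLint.2, sub_zero]
  rw [e]
  calc _ ≤ ∫ x, (200 * A * (1 + |y|) ^ (-(3/2) : ℝ)) * maj y x := by
        refine norm_integral_le_of_norm_le ((int_maj y).const_mul _) (ae_of_all _ fun x => ?_)
        rw [norm_mul, Complex.norm_real, Real.norm_eq_abs]
        have hw := one_le_wt (y - x)
        calc _ ≤ (200 * (1 + |y|) ^ (-(3/2) : ℝ) * (1 + |x|) ^ 4 * wt (y - x)) * |η x| := by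
              gcongr
              exact kern_pointwise z h0 h1 him y x
          _ = 200 * (1 + |y|) ^ (-(3/2) : ℝ) * wt (y - x) * (|η x| * (1 + |x|) ^ 4) := by ring
          _ ≤ 200 * (1 + |y|) ^ (-(3/2) : ℝ) * wt (y - x) * (A * (1 + |x|) ^ (-2 : ℝ)) := by
              gcongr ?_ * ?_
              exact pow_jap η A hA x
          _ = 200 * A * (1 + |y|) ^ (-(3/2) : ℝ) * (wt (y - x) * (1 + |x|) ^ (-2 : ℝ)) := by ring
          _ ≤ _ := by gcongr; exact wt_le_maj y x
    _ = _ := by rw [integral_const_mul, integral_maj]; ring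

/-- Hölder bound for `Phi`. -/
lemma Phi_holder (η : ℝ → ℝ) (hd : Differentiable ℝ η) (A A' : ℝ)
    (hA : ∀ x, |η x| * (1 + |x|) ^ 6 ≤ A) (hA' : ∀ x, |deriv η x| * (1 + |x|) ^ 6 ≤ A')
    (hm0 : ∫ x, η x = 0) (hm1 : ∫ x, x * η x = 0)
    (y₁ y₂ : ℝ) (z : ℂ) (h0 : 0 < z.re) (h1 : z.re < 1) (him : |z.im| < 1)
    (α : ℝ) (hα0 : 0 ≤ α) (hα1 : α ≤ 1) :
    ‖Phi η y₁ z - Phi η y₂ z‖ ≤ 200 * majC * (A + 64 * A') * |y₁ - y₂| ^ α *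
      ((1 + |y₁|) ^ (-(3/2) : ℝ) + (1 + |y₂|) ^ (-(3/2) : ℝ)) := by
  have hc := hd.continuous
  have hA0 : 0 ≤ A := le_trans (by positivity) (hA 0)
  have hA0' : 0 ≤ A' := le_trans (by positivity) (hA' 0)
  have hM := majC_nonneg
  have p1 : 0 ≤ (1 + |y₁|) ^ (-(3/2) : ℝ) := rpow_nonneg (by positivity) _
  have p2 : 0 ≤ (1 + |y₂|) ^ (-(3/2) : ℝ) := rpow_nonneg (by positivity) _
  rcases le_total |y₁ - y₂| 1 with hh | hh
  · set h := y₁ - y₂ with hhdef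
    obtain ⟨i0, i1⟩ := eta_int η hc A hA
    have i0s := i0.comp_sub_right h
    have i1s := i1.comp_sub_right h
    have hb : ∀ x, |η x - η (x - h)| * (1 + |x|) ^ 6 ≤ 64 * A' * |h| := by
      intro x
      have := (convex_uIcc (x - h) x).norm_image_sub_le_of_norm_deriv_le (f := η)
        (C := 64 * A' / (1 + |x|) ^ 6) (fun w _ => hd w) ?_ left_mem_uIcc right_mem_uIcc
      · rw [Real.norm_eq_abs, Real.norm_eq_abs, div_mul_eq_mul_div, le_div_iff₀ (by positivity)] at this
        simpa using this
      · intro w hw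
        have hxw : |x - w| ≤ |h| := by
          have := abs_sub_right_of_mem_uIcc hw
          simpa using this
        have h2 : 1 + |x| ≤ 2 * (1 + |w|) := by
          have h3 : |x| ≤ |x - w| + |w| := by simpa using abs_add_le (x - w) w
          linarith [abs_nonneg w]
        rw [Real.norm_eq_abs, le_div_iff₀ (by positivity)]
        calc |deriv η w| * (1 + |x|) ^ 6 ≤ |deriv η w| * (2 * (1 + |w|)) ^ 6 := by gcongr
          _ = 64 * (|deriv η w| * (1 + |w|) ^ 6) := by ring
          _ ≤ _ := by gcongr; exact hA' w
    have e : Phi η y₁ z - Phi η y₂ z = Phi (fun x => η x - η (x - h)) y₁ z := by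
      have e2 : Phi η y₂ z = ∫ x, kern z (y₁ - x) * (η (x - h) : ℂ) := by
        unfold Phi
        rw [← integral_sub_right_eq_self (fun x => kern z (y₂ - x) * (η x : ℂ)) h]
        congr 1; funext x
        rw [show y₂ - (x - h) = y₁ - x by rw [hhdef]; ring]
      have i2 : Integrable (fun x => kern z (y₁ - x) * (η (x - h) : ℂ)) := by
        have := (Phi_integrable η hc A hA y₂ z h0 h1).comp_sub_right h
        refine this.congr (ae_of_all _ fun x => ?_)
        simp only
        rw [show y₂ - (x - h) = y₁ - x by rw [hhdef]; ring]
      rw [e2]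
      unfold Phi
      rw [← integral_sub (Phi_integrable η hc A hA y₁ z h0 h1) i2]
      congr 1; funext x
      push_cast; ring
    have hm0' : ∫ x, (η x - η (x - h)) = 0 := by
      rw [integral_sub i0 i0s, integral_sub_right_eq_self η h]; simp
    have hm1' : ∫ x, x * (η x - η (x - h)) = 0 := by
      have : ∀ x, x * (η x - η (x - h)) = x * η x - ((x - h) * η (x - h) + h * η (x - h)) := by
        intro x; ring
      simp_rw [this]
      have i2s : Integrable (fun x => (x - h) * η (x - h) + h * η (x - h)) :=
        i1s.add (i0s.const_mul h)
      rw [integral_sub i1 i2s, integral_add i1s (i0s.const_mul h),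
        integral_const_mul, integral_sub_right_eq_self η h,
        integral_sub_right_eq_self (fun x => x * η x) h, hm0, hm1]
      simp
    rw [e]
    have := Phi_decay (fun x => η x - η (x - h)) (hc.sub (hc.comp (continuous_id.sub continuous_const)))
      _ hb hm0' hm1' y₁ z h0 h1 him
    refine this.trans ?_
    have hα : |h| ≤ |h| ^ α := by
      rcases (abs_nonneg h).eq_or_lt with h' | h'
      · rw [← h']; exact rpow_nonneg le_rfl _
      · calc |h| = |h| ^ (1:ℝ) := (rpow_one _).symm
          _ ≤ |h| ^ α := rpow_le_rpow_of_exponent_ge h' hh hα1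
    calc _ = 200 * majC * (64 * A') * |h| * (1 + |y₁|) ^ (-(3/2) : ℝ) := by ring
      _ ≤ _ := by
        gcongr
        · linarith
        · linarith
  · have hα : 1 ≤ |y₁ - y₂| ^ α := one_le_rpow hh hα0
    have d1 := Phi_decay η hc A hA hm0 hm1 y₁ z h0 h1 him
    have d2 := Phi_decay η hc A hA hm0 hm1 y₂ z h0 h1 him
    calc _ ≤ 200 * majC * A * 1 *
      ((1 + |y₁|) ^ (-(3/2) : ℝ) + (1 + |y₂|) ^ (-(3/2) : ℝ)) := by
          refine (norm_sub_le _ _).trans ?_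
          linarith
      _ ≤ _ := by
        gcongr
        linarith

lemma Phi_differentiable (η : ℝ → ℝ) (hc : Continuous η) (A : ℝ)
    (hA : ∀ x, |η x| * (1 + |x|) ^ 6 ≤ A) (y : ℝ) (z : ℂ) (h0 : 0 < z.re) (h1 : z.re < 1) :
    DifferentiableAt ℂ (Phi η y) z := by
  have hA0 : 0 ≤ A := le_trans (by positivity) (hA 0)
  have e : Phi η y = fun z => mellin (fun u => (η (y - u) : ℂ)) (z + 1/2) := by
    funext z
    unfold Phi mellin
    rw [← integral_sub_left_eq_self _ volume y, ← integral_indicator measurableSet_Ioi]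
    congr 1; funext u
    unfold kern
    by_cases hu : 0 < u
    · rw [indicator_of_mem (show u ∈ Ioi (0:ℝ) from hu)]
      simp only [sub_sub_cancel, if_pos hu, smul_eq_mul]
      congr 2
      ring
    · rw [indicator_of_notMem (show u ∉ Ioi (0:ℝ) from hu)]
      simp [hu]
  rw [e]
  have hcc : Continuous (fun u => (η (y - u) : ℂ)) :=
    Complex.continuous_ofReal.comp (hc.comp (continuous_const.sub continuous_id))
  have hm : DifferentiableAt ℂ (mellin (fun u => (η (y - u) : ℂ))) (z + 1/2) := by
    refine mellin_differentiableAt_of_isBigO_rpow (a := 2) (b := 0)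
      (hcc.locallyIntegrable.locallyIntegrableOn _) ?_ ?_ ?_ ?_
    · refine Asymptotics.IsBigO.of_bound (A * (1 + |y|) ^ 2) ?_
      filter_upwards [Filter.eventually_gt_atTop 0] with u hu
      rw [Complex.norm_real, Real.norm_eq_abs, Real.norm_eq_abs, abs_of_nonneg (rpow_nonneg hu.le _),
        rpow_neg hu.le, ← div_eq_mul_inv, le_div_iff₀ (rpow_pos_of_pos hu _)]
      have h1 : u ≤ (1 + |y|) * (1 + |y - u|) := by
        have : |u| ≤ |y| + |y - u| := by
          have := abs_sub y (y - u); simpa using this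
        rw [abs_of_pos hu] at this
        nlinarith [abs_nonneg y, abs_nonneg (y - u)]
      have h2 : u ^ (2:ℝ) = u ^ 2 := by norm_num
      rw [h2]
      calc |η (y - u)| * u ^ 2 ≤ |η (y - u)| * ((1 + |y|) * (1 + |y - u|)) ^ 2 := by gcongr
        _ = (|η (y - u)| * (1 + |y - u|) ^ 2) * (1 + |y|) ^ 2 := by ring
        _ ≤ (|η (y - u)| * (1 + |y - u|) ^ 6) * (1 + |y|) ^ 2 := by
          gcongr
          · linarith [abs_nonneg (y - u)]
          · norm_num
        _ ≤ _ := by gcongr; exact hA _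
    · simp; linarith
    · refine Asymptotics.IsBigO.of_bound A ?_
      refine Filter.Eventually.of_forall fun u => ?_
      rw [Complex.norm_real, Real.norm_eq_abs]
      simp only [neg_zero, rpow_zero, norm_one, mul_one]
      exact le_trans (le_mul_of_one_le_right (abs_nonneg _)
        (one_le_pow₀ (by linarith [abs_nonneg (y - u)]))) (hA _)
    · simp; linarith
  have hg : DifferentiableAt ℂ (fun z : ℂ => z + 1/2) z := differentiableAt_id.add_const _
  exact DifferentiableAt.comp (g := mellin (fun u => (η (y - u) : ℂ))) z hm hg

lemma schwartz_bound (ψ : SchwartzMap ℝ ℝ) : ∃ A : ℝ, ∀ x, |ψ x| * (1 + |x|) ^ 6 ≤ A := by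
  refine ⟨2 ^ 6 * (Finset.Iic ((6, 0) : ℕ × ℕ)).sup
    (fun m => SchwartzMap.seminorm ℝ m.1 m.2) ψ, fun x => ?_⟩
  have := SchwartzMap.one_add_le_sup_seminorm_apply (𝕜 := ℝ) (m := (6, 0)) le_rfl le_rfl ψ x
  rw [norm_iteratedFDeriv_zero, mul_comm] at this
  exact this

lemma schwartz_bound' (ψ : SchwartzMap ℝ ℝ) :
    ∃ A : ℝ, ∀ x, |deriv (fun x => ψ x) x| * (1 + |x|) ^ 6 ≤ A := by
  obtain ⟨A, hA⟩ := schwartz_bound (SchwartzMap.derivCLM ℝ ℝ ψ)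
  refine ⟨A, fun x => ?_⟩
  have := hA x
  rw [SchwartzMap.derivCLM_apply] at this
  exact this

lemma moments (η : ℝ → ℝ) (hc : Continuous η) (A : ℝ) (hA : ∀ x, |η x| * (1 + |x|) ^ 6 ≤ A)
    (hsupp : ∀ ξ : ℝ, |ξ| < 2 * π / 3 → fourierT η ξ = 0) :
    ∫ x, η x = 0 ∧ ∫ x, x * η x = 0 := by
  obtain ⟨i0, i1⟩ := eta_int η hc A hA
  have hpi : 0 < 2 * π / 3 := by positivity
  constructor
  · have := hsupp 0 (by simpa using hpi)
    unfold fourierT at this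
    simp only [Complex.ofReal_zero, mul_zero, zero_mul, neg_zero, Complex.exp_zero, one_mul] at this
    rw [integral_complex_ofReal] at this
    exact_mod_cast this
  · have hcF : ∀ ξ : ℝ, Continuous (fun x : ℝ => Complex.exp (-(Complex.I * ξ * x)) * (η x : ℂ)) := by
      intro ξ; fun_prop
    have hnorm : ∀ ξ x : ℝ, ‖Complex.exp (-(Complex.I * ξ * x))‖ = 1 := by
      intro ξ x
      rw [show -(Complex.I * ξ * x) = ((-(ξ * x) : ℝ) : ℂ) * Complex.I by push_cast; ring]
      exact Complex.norm_exp_ofReal_mul_I _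
    have hD := (hasDerivAt_integral_of_dominated_loc_of_deriv_le (μ := volume) (𝕜 := ℝ)
      (F := fun (ξ : ℝ) (x : ℝ) => Complex.exp (-(Complex.I * ξ * x)) * (η x : ℂ))
      (F' := fun (ξ : ℝ) (x : ℝ) => Complex.exp (-(Complex.I * ξ * x)) * (-(Complex.I * x)) * (η x : ℂ))
      (x₀ := 0) (s := univ) (bound := fun x => ‖x * η x‖) Filter.univ_mem
      (Filter.Eventually.of_forall fun ξ => (hcF ξ).aestronglyMeasurable) ?_ ?_ ?_ i1.norm ?_).2
    · have hz : HasDerivAt (fun ξ : ℝ => ∫ x : ℝ, Complex.exp (-(Complex.I * ξ * x)) * (η x : ℂ)) 0 0 := by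
        refine (hasDerivAt_const (0:ℝ) (0:ℂ)).congr_of_eventuallyEq ?_
        have : ∀ᶠ ξ in nhds (0:ℝ), |ξ| < 2 * π / 3 := by
          have hcont : Continuous (fun ξ : ℝ => |ξ|) := continuous_abs
          exact hcont.continuousAt.eventually_lt continuousAt_const (by simpa using hpi)
        filter_upwards [this] with ξ hξ
        exact hsupp ξ hξ
      have h := hD.unique hz
      simp only [Complex.ofReal_zero, mul_zero, zero_mul, neg_zero, Complex.exp_zero, one_mul] at h
      have e : ∀ x : ℝ, -(Complex.I * x) * (η x : ℂ) = (-Complex.I) * ((x * η x : ℝ) : ℂ) := by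
        intro x; push_cast; ring
      simp_rw [e] at h
      rw [integral_const_mul, integral_complex_ofReal] at h
      have := (mul_eq_zero.1 h).resolve_left (by simp)
      exact_mod_cast this
    · refine i0.norm.mono' (hcF 0).aestronglyMeasurable (ae_of_all _ fun x => ?_)
      rw [norm_mul, hnorm]; simp
    · have : Continuous (fun x : ℝ => Complex.exp (-(Complex.I * (0:ℝ) * x)) * (-(Complex.I * x)) * (η x : ℂ)) := by
        fun_prop
      exact this.aestronglyMeasurable
    · refine ae_of_all _ fun x ξ _ => ?_
      rw [norm_mul, norm_mul, hnorm]; simp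
    · refine ae_of_all _ fun x ξ _ => ?_
      have h1 : HasDerivAt (fun w : ℂ => -(Complex.I * w * x)) (-(Complex.I * x)) (ξ : ℂ) := by
        have := (((hasDerivAt_id (ξ : ℂ)).const_mul Complex.I).mul_const (x : ℂ)).neg
        rw [mul_one] at this
        exact this
      exact (h1.cexp.mul_const (η x : ℂ)).comp_ofReal

/-- summable comparison sequence -/
def qq (k : ℤ) : ℝ := 4 * (1 + |(k:ℝ)|) ^ (-(5/4) : ℝ)

lemma qq_nonneg (k : ℤ) : 0 ≤ qq k := by
  unfold qq; have := rpow_nonneg (show 0 ≤ 1 + |(k:ℝ)| by positivity) (-(5/4) : ℝ); linarith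

lemma qq_summable : Summable qq := by
  refine Summable.mul_left 4 ?_
  have h := (Real.summable_one_div_int_add_rpow (1/2) (5/4)).2 (by norm_num)
  refine h.of_nonneg_of_le (fun k => rpow_nonneg (by positivity) _) fun k => ?_
  have hk : (0:ℝ) < |(k:ℝ) + 1/2| := by
    rw [abs_pos]
    intro h0
    have h2 : (2 * k + 1 : ℤ) = 0 := by
      have : (2 * (k:ℝ) + 1) = 0 := by linarith
      exact_mod_cast this
    omega
  rw [rpow_neg (by positivity), one_div]
  gcongr
  have := abs_add_le (k:ℝ) (1/2)
  rw [abs_of_pos (show (0:ℝ) < 1/2 by norm_num)] at this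
  linarith

lemma qq_shift_summable (m : ℤ) : Summable (fun k => qq (k - m)) :=
  (Equiv.subRight m).summable_iff.2 qq_summable

lemma qq_shift_tsum (m : ℤ) : ∑' k, qq (k - m) = ∑' k, qq k :=
  (Equiv.subRight m).tsum_eq qq

lemma term_bound (δ : ℝ) (h0 : 0 ≤ δ) (h1 : δ ≤ 1/4) (x : ℝ) (k : ℤ) :
    (1 + |(k:ℝ)|) ^ δ * (1 + |x - k|) ^ (-(3/2) : ℝ) ≤ (1 + |x|) ^ δ * qq (k - ⌊x⌋) := by
  have hx := abs_nonneg x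
  have hp : 0 < 1 + |x - k| := by positivity
  have hk : 1 + |(k:ℝ)| ≤ (1 + |x|) * (1 + |x - k|) := by
    have : |(k:ℝ)| ≤ |x| + |x - k| := by simpa using abs_sub x (x - k)
    nlinarith [abs_nonneg (x - k)]
  have hf : 1 + |((k - ⌊x⌋ : ℤ) : ℝ)| ≤ 2 * (1 + |x - k|) := by
    push_cast
    have h2 : |(k:ℝ) - ⌊x⌋| ≤ |x - k| + 1 := by
      have h3 : (k:ℝ) - ⌊x⌋ = -(x - k) + Int.fract x := by
        rw [← Int.self_sub_floor x]; ring
      rw [h3]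
      refine (abs_add_le _ _).trans ?_
      rw [abs_neg, abs_of_nonneg (Int.fract_nonneg x)]
      linarith [Int.fract_lt_one x]
    linarith [abs_nonneg (x - k)]
  calc _ ≤ ((1 + |x|) * (1 + |x - k|)) ^ δ * (1 + |x - k|) ^ (-(3/2) : ℝ) := by gcongr
    _ = (1 + |x|) ^ δ * (1 + |x - k|) ^ (δ - 3/2) := by
        rw [mul_rpow (by positivity) hp.le, mul_assoc, ← rpow_add hp]; congr 2
    _ ≤ (1 + |x|) ^ δ * (1 + |x - k|) ^ (-(5/4) : ℝ) := by
        gcongr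
        · linarith [abs_nonneg (x - k)]
        · linarith
    _ ≤ (1 + |x|) ^ δ * qq (k - ⌊x⌋) := by
        gcongr
        unfold qq
        calc (1 + |x - k|) ^ (-(5/4) : ℝ)
            ≤ ((1 + |((k - ⌊x⌋ : ℤ) : ℝ)|) / 2) ^ (-(5/4) : ℝ) :=
              rpow_le_rpow_of_nonpos (by positivity) (by linarith) (by norm_num)
          _ ≤ _ := by
            rw [div_rpow (by positivity) (by norm_num), rpow_neg (by norm_num : (0:ℝ) ≤ 2),
                  div_inv_eq_mul, mul_comm]
            gcongr
            calc (2:ℝ) ^ (5/4 : ℝ) ≤ 2 ^ (2:ℝ) :=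
                  rpow_le_rpow_of_exponent_le (by norm_num) (by norm_num)
              _ = 4 := by norm_num

lemma e_bound (e : ℤ × ℤ → ℝ) (C₀ : ℝ)
    (hbd : ∀ j k : ℤ, |e (j, k)|
      ≤ C₀ * Real.sqrt (Real.log (2 + |(j : ℝ)|) * Real.log (2 + |(k : ℝ)|)))
    (δ : ℝ) (hδ : 0 < δ) : ∃ E : ℝ, 0 ≤ E ∧ ∀ (j : ℕ) (k : ℤ),
      |e ((j:ℤ) + 1, k)| ≤ E * ((2:ℝ) ^ j) ^ δ * (1 + |(k:ℝ)|) ^ δ := by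
  refine ⟨|C₀| * (8 ^ δ / (2 * δ)), by positivity, fun j k => ?_⟩
  refine (hbd _ _).trans ?_
  have hj : Real.log (2 + |(((j:ℤ) + 1 : ℤ) : ℝ)|) ≤ (4 * 2 ^ j) ^ (2 * δ) / (2 * δ) := by
    have h1 : 2 + |(((j:ℤ) + 1 : ℤ) : ℝ)| ≤ 4 * 2 ^ j := by
      push_cast
      rw [abs_of_nonneg (by positivity)]
      have : (j:ℝ) + 1 ≤ 2 ^ j := by exact_mod_cast Nat.lt_two_pow_self
      have h2 : (1:ℝ) ≤ 2 ^ j := one_le_pow₀ (by norm_num)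
      linarith
    refine (Real.log_le_log (by positivity) h1).trans ?_
    exact Real.log_le_rpow_div (by positivity) (by positivity)
  have hk : Real.log (2 + |(k : ℝ)|) ≤ (2 * (1 + |(k:ℝ)|)) ^ (2 * δ) / (2 * δ) := by
    refine (Real.log_le_log (by positivity) (show _ ≤ 2 * (1 + |(k:ℝ)|) by
      linarith [abs_nonneg (k:ℝ)])).trans ?_
    exact Real.log_le_rpow_div (by positivity) (by positivity)
  have hk0 : 0 ≤ Real.log (2 + |(k : ℝ)|) := Real.log_nonneg (by linarith [abs_nonneg (k:ℝ)])
  have hs : Real.sqrt (Real.log (2 + |(((j:ℤ) + 1 : ℤ) : ℝ)|) * Real.log (2 + |(k : ℝ)|))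
      ≤ 8 ^ δ * ((2:ℝ) ^ j) ^ δ * (1 + |(k:ℝ)|) ^ δ / (2 * δ) := by
    refine Real.sqrt_le_iff.2 ⟨by positivity, ?_⟩
    refine (mul_le_mul hj hk hk0 (by positivity)).trans (le_of_eq ?_)
    have e1 : ∀ w : ℝ, 0 ≤ w → w ^ (2 * δ) = (w ^ δ) ^ 2 := by
      intro w hw
      rw [mul_comm, rpow_mul hw]; norm_num
    rw [e1 _ (by positivity), e1 _ (by positivity), show (8:ℝ) = 4 * 2 by norm_num,
      mul_rpow (by norm_num) (by positivity), mul_rpow (by norm_num) (by positivity),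
      mul_rpow (by norm_num) (by norm_num)]
    ring
  calc _ ≤ |C₀| * _ := mul_le_mul_of_nonneg_right (le_abs_self C₀) (Real.sqrt_nonneg _)
    _ ≤ |C₀| * _ := mul_le_mul_of_nonneg_left hs (abs_nonneg _)
    _ = _ := by ring

/-- complex extension -/
def Bc (η : ℝ → ℝ) (e : ℤ × ℤ → ℝ) (t : ℝ) (z : ℂ) : ℂ :=
  ∑' j : ℕ, (2:ℂ) ^ (-((j : ℂ) + 1) * z)
    * ∑' k : ℤ, (e ((j : ℤ) + 1, k) : ℂ) * Phi η ((2:ℝ) ^ ((j : ℤ) + 1) * t - (k : ℝ)) z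

lemma Phi_ofReal (η : ℝ → ℝ) (y θ : ℝ) : Phi η y θ = (PsiFrac η y θ : ℂ) := by
  unfold Phi PsiFrac
  rw [← integral_complex_ofReal]
  congr 1; funext x
  unfold kern posRPow
  split_ifs with h
  · push_cast
    rw [Complex.ofReal_cpow h.le]
    push_cast; rfl
  · simp

lemma Bc_ofReal (η : ℝ → ℝ) (e : ℤ × ℤ → ℝ) (t θ : ℝ) : Bc η e t θ = (Btwo η e t θ : ℂ) := by
  unfold Bc Btwo
  rw [Complex.ofReal_tsum]
  congr 1; funext j
  rw [Complex.ofReal_mul, Complex.ofReal_tsum, Complex.ofReal_cpow (by norm_num)]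
  congr 1
  · push_cast; rfl
  · congr 1; funext k
    rw [Phi_ofReal]; push_cast; rfl

lemma deriv_transfer (F : ℂ → ℂ) (f : ℝ → ℝ) (U : Set ℂ) (hU : IsOpen U)
    (hF : DifferentiableOn ℂ F U) (hf : ∀ x : ℝ, F x = (f x : ℂ)) (n : ℕ) :
    ∀ θ : ℝ, (θ : ℂ) ∈ U → θ ∈ Ioo (0:ℝ) 1 →
      iteratedDerivWithin n f (Ioo (0:ℝ) 1) θ = (iteratedDeriv n F θ).re := by
  induction n with
  | zero => intro θ _ _; simp [hf]
  | succ n ih =>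
    intro θ hθ h01
    rw [iteratedDerivWithin_succ, iteratedDeriv_succ, derivWithin_of_isOpen isOpen_Ioo h01]
    have hd : DifferentiableAt ℂ (iteratedDeriv n F) θ := by
      have hA : AnalyticAt ℂ F θ := hF.analyticAt (hU.mem_nhds hθ)
      rw [iteratedDeriv_eq_iterate]
      exact (AnalyticAt.iterated_deriv hA n).differentiableAt
    have h1 := hd.hasDerivAt.real_of_complex
    have hev : iteratedDerivWithin n f (Ioo (0:ℝ) 1) =ᶠ[nhds θ]
        fun x : ℝ => (iteratedDeriv n F x).re := by
      have hU' : ∀ᶠ x : ℝ in nhds θ, (x : ℂ) ∈ U :=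
        Complex.continuous_ofReal.continuousAt.eventually (hU.mem_nhds hθ)
      filter_upwards [hU', isOpen_Ioo.mem_nhds h01] with x hx hx'
      exact ih x hx hx'
    rw [hev.deriv_eq, h1.deriv]

/-- the ambient half strip -/
def UU (a : ℝ) : Set ℂ := {z | a < z.re ∧ z.re < 1 ∧ |z.im| < 1}

lemma UU_open (a : ℝ) : IsOpen (UU a) :=
  (isOpen_lt continuous_const Complex.continuous_re).inter
    ((isOpen_lt Complex.continuous_re continuous_const).inter
      (isOpen_lt (continuous_abs.comp Complex.continuous_im) continuous_const))

lemma inner_term (c : ℝ) (f : ℂ) (R P δ x : ℝ) (k : ℤ) (h0 : 0 ≤ δ) (h1 : δ ≤ 1/4)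
    (hR : 0 ≤ R) (hP : 0 ≤ P)
    (hc : |c| ≤ R * (1 + |(k:ℝ)|) ^ δ) (hf : ‖f‖ ≤ P * (1 + |x - k|) ^ (-(3/2) : ℝ)) :
    ‖(c:ℂ) * f‖ ≤ R * P * (1 + |x|) ^ δ * qq (k - ⌊x⌋) := by
  rw [norm_mul, Complex.norm_real, Real.norm_eq_abs]
  calc |c| * ‖f‖ ≤ (R * (1 + |(k:ℝ)|) ^ δ) * (P * (1 + |x - k|) ^ (-(3/2) : ℝ)) := by gcongr
    _ = R * P * ((1 + |(k:ℝ)|) ^ δ * (1 + |x - k|) ^ (-(3/2) : ℝ)) := by ring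
    _ ≤ R * P * ((1 + |x|) ^ δ * qq (k - ⌊x⌋)) := by
        gcongr ?_ * ?_
        exact term_bound δ h0 h1 x k
    _ = _ := by ring

lemma x_bound (t M : ℝ) (ht : |t| ≤ M) (j : ℕ) (δ : ℝ) (hδ : 0 ≤ δ) :
    (1 + |(2:ℝ) ^ ((j:ℤ) + 1) * t|) ^ δ ≤ (1 + 2 * M) ^ δ * ((2:ℝ) ^ j) ^ δ := by
  have hM : 0 ≤ M := (abs_nonneg t).trans ht
  rw [← mul_rpow (by positivity) (by positivity)]
  refine rpow_le_rpow (by positivity) ?_ hδ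
  have h2 : (1:ℝ) ≤ 2 ^ j := one_le_pow₀ (by norm_num)
  have e : (2:ℝ) ^ ((j:ℤ) + 1) = 2 ^ j * 2 := by
    rw [zpow_add₀ (by norm_num), zpow_natCast, zpow_one]
  rw [e, abs_mul, abs_of_pos (by positivity)]
  have : (2:ℝ) ^ j * 2 * |t| ≤ 2 ^ j * 2 * M := by gcongr
  linarith

/-- inner sum -/
def SS (η : ℝ → ℝ) (e : ℤ × ℤ → ℝ) (t : ℝ) (j : ℕ) (z : ℂ) : ℂ :=
  ∑' k : ℤ, (e ((j : ℤ) + 1, k) : ℂ) * Phi η ((2:ℝ) ^ ((j : ℤ) + 1) * t - (k : ℝ)) z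

lemma SS_term (η : ℝ → ℝ) (e : ℤ × ℤ → ℝ)
    (hd : Differentiable ℝ η) (A : ℝ)
    (hA : ∀ x, |η x| * (1 + |x|) ^ 6 ≤ A)
    (hm0 : ∫ x, η x = 0) (hm1 : ∫ x, x * η x = 0)
    (E δ : ℝ) (hE : 0 ≤ E) (h0 : 0 ≤ δ) (h1 : δ ≤ 1/4)
    (he : ∀ (j : ℕ) (k : ℤ), |e ((j:ℤ) + 1, k)| ≤ E * ((2:ℝ) ^ j) ^ δ * (1 + |(k:ℝ)|) ^ δ)
    (t : ℝ) (j : ℕ) (k : ℤ) (z : ℂ) (hz : z ∈ UU 0) :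
    ‖(e ((j : ℤ) + 1, k) : ℂ) * Phi η ((2:ℝ) ^ ((j : ℤ) + 1) * t - (k : ℝ)) z‖ ≤
      E * ((2:ℝ) ^ j) ^ δ * (200 * majC * A) * (1 + |(2:ℝ) ^ ((j:ℤ) + 1) * t|) ^ δ *
        qq (k - ⌊(2:ℝ) ^ ((j:ℤ) + 1) * t⌋) := by
  have hA0 : 0 ≤ A := le_trans (by positivity) (hA 0)
  have hM := majC_nonneg
  exact inner_term _ _ _ _ _ _ _ h0 h1 (by positivity) (by positivity) (he j k)
    (Phi_decay η hd.continuous A hA hm0 hm1 _ z hz.1 hz.2.1 hz.2.2)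

lemma SS_diffOn (η : ℝ → ℝ) (e : ℤ × ℤ → ℝ)
    (hd : Differentiable ℝ η) (A : ℝ)
    (hA : ∀ x, |η x| * (1 + |x|) ^ 6 ≤ A)
    (hm0 : ∫ x, η x = 0) (hm1 : ∫ x, x * η x = 0)
    (E δ : ℝ) (hE : 0 ≤ E) (h0 : 0 ≤ δ) (h1 : δ ≤ 1/4)
    (he : ∀ (j : ℕ) (k : ℤ), |e ((j:ℤ) + 1, k)| ≤ E * ((2:ℝ) ^ j) ^ δ * (1 + |(k:ℝ)|) ^ δ)
    (t : ℝ) (j : ℕ) : DifferentiableOn ℂ (SS η e t j) (UU 0) := by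
  refine Complex.differentiableOn_tsum_of_summable_norm
    (u := fun k => E * ((2:ℝ) ^ j) ^ δ * (200 * majC * A) * (1 + |(2:ℝ) ^ ((j:ℤ) + 1) * t|) ^ δ *
        qq (k - ⌊(2:ℝ) ^ ((j:ℤ) + 1) * t⌋)) ((qq_shift_summable _).mul_left _) ?_ (UU_open 0) ?_
  · intro k z hz
    exact ((Phi_differentiable η hd.continuous A hA _ z hz.1 hz.2.1).const_mul _).differentiableWithinAt
  · intro k z hz
    exact SS_term η e hd A hA hm0 hm1 E δ hE h0 h1 he t j k z hz

lemma SS_bound (η : ℝ → ℝ) (e : ℤ × ℤ → ℝ)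
    (hd : Differentiable ℝ η) (A : ℝ)
    (hA : ∀ x, |η x| * (1 + |x|) ^ 6 ≤ A)
    (hm0 : ∫ x, η x = 0) (hm1 : ∫ x, x * η x = 0)
    (E δ M : ℝ) (hE : 0 ≤ E) (h0 : 0 ≤ δ) (h1 : δ ≤ 1/4)
    (he : ∀ (j : ℕ) (k : ℤ), |e ((j:ℤ) + 1, k)| ≤ E * ((2:ℝ) ^ j) ^ δ * (1 + |(k:ℝ)|) ^ δ)
    (t : ℝ) (ht : |t| ≤ M) (j : ℕ) (z : ℂ) (hz : z ∈ UU 0) :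
    ‖SS η e t j z‖ ≤ E * (200 * majC * A) * (1 + 2 * M) ^ δ * (∑' k, qq k) *
      (((2:ℝ) ^ j) ^ δ * ((2:ℝ) ^ j) ^ δ) := by
  have hA0 : 0 ≤ A := le_trans (by positivity) (hA 0)
  have hM := majC_nonneg
  have hQ : 0 ≤ ∑' k, qq k := tsum_nonneg qq_nonneg
  have hs := ((qq_shift_summable ⌊(2:ℝ) ^ ((j:ℤ) + 1) * t⌋).hasSum).mul_left
    (E * ((2:ℝ) ^ j) ^ δ * (200 * majC * A) * (1 + |(2:ℝ) ^ ((j:ℤ) + 1) * t|) ^ δ)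
  rw [qq_shift_tsum] at hs
  refine (tsum_of_norm_bounded hs
    (fun k => SS_term η e hd A hA hm0 hm1 E δ hE h0 h1 he t j k z hz)).trans ?_
  calc _ ≤ E * ((2:ℝ) ^ j) ^ δ * (200 * majC * A) * ((1 + 2 * M) ^ δ * ((2:ℝ) ^ j) ^ δ) *
        (∑' k, qq k) := by
        gcongr ?_ * ?_ * ?_
        exact x_bound t M ht j δ h0
    _ = _ := by ring

lemma SS_holder (η : ℝ → ℝ) (e : ℤ × ℤ → ℝ)
    (hd : Differentiable ℝ η) (A A' : ℝ)
    (hA : ∀ x, |η x| * (1 + |x|) ^ 6 ≤ A) (hA' : ∀ x, |deriv η x| * (1 + |x|) ^ 6 ≤ A')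
    (hm0 : ∫ x, η x = 0) (hm1 : ∫ x, x * η x = 0)
    (E δ M : ℝ) (hE : 0 ≤ E) (h0 : 0 ≤ δ) (h1 : δ ≤ 1/4)
    (he : ∀ (j : ℕ) (k : ℤ), |e ((j:ℤ) + 1, k)| ≤ E * ((2:ℝ) ^ j) ^ δ * (1 + |(k:ℝ)|) ^ δ)
    (t₁ t₂ : ℝ) (ht₁ : |t₁| ≤ M) (ht₂ : |t₂| ≤ M) (j : ℕ) (z : ℂ) (hz : z ∈ UU 0)
    (α : ℝ) (hα0 : 0 ≤ α) (hα1 : α ≤ 1) :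
    ‖SS η e t₁ j z - SS η e t₂ j z‖ ≤
      4 * E * (200 * majC * (A + 64 * A')) * (1 + 2 * M) ^ δ * (∑' k, qq k) *
      (((2:ℝ) ^ j) ^ δ * ((2:ℝ) ^ j) ^ δ * ((2:ℝ) ^ j) ^ α * |t₁ - t₂| ^ α) := by
  have hA0 : 0 ≤ A := le_trans (by positivity) (hA 0)
  have hA0' : 0 ≤ A' := le_trans (by positivity) (hA' 0)
  have hM := majC_nonneg
  have hM0 : 0 ≤ M := (abs_nonneg _).trans ht₁
  have hQ : 0 ≤ ∑' k, qq k := tsum_nonneg qq_nonneg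
  set x₁ := (2:ℝ) ^ ((j:ℤ) + 1) * t₁ with hx₁
  set x₂ := (2:ℝ) ^ ((j:ℤ) + 1) * t₂ with hx₂
  have hsum : ∀ t, Summable (fun k : ℤ =>
      (e ((j : ℤ) + 1, k) : ℂ) * Phi η ((2:ℝ) ^ ((j : ℤ) + 1) * t - (k : ℝ)) z) := fun t =>
    Summable.of_norm_bounded ((qq_shift_summable _).mul_left _)
      (fun k => SS_term η e hd A hA hm0 hm1 E δ hE h0 h1 he t j k z hz)
  unfold SS
  rw [← (hsum t₁).tsum_sub (hsum t₂)]
  set P := 200 * majC * (A + 64 * A') * |x₁ - x₂| ^ α with hP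
  have hP0 : 0 ≤ P := by positivity
  set R := E * ((2:ℝ) ^ j) ^ δ with hR
  have hR0 : 0 ≤ R := by positivity
  have hterm : ∀ k : ℤ, ‖(e ((j : ℤ) + 1, k) : ℂ) * Phi η (x₁ - (k : ℝ)) z -
      (e ((j : ℤ) + 1, k) : ℂ) * Phi η (x₂ - (k : ℝ)) z‖ ≤
      R * P * (1 + |x₁|) ^ δ * qq (k - ⌊x₁⌋) + R * P * (1 + |x₂|) ^ δ * qq (k - ⌊x₂⌋) := by
    intro k
    have hh := Phi_holder η hd A A' hA hA' hm0 hm1 (x₁ - k) (x₂ - k) z hz.1 hz.2.1 hz.2.2 α hα0 hα1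
    rw [show x₁ - (k:ℝ) - (x₂ - k) = x₁ - x₂ by ring, ← hP] at hh
    rw [← mul_sub, norm_mul, Complex.norm_real, Real.norm_eq_abs]
    have b1 := term_bound δ h0 h1 x₁ k
    have b2 := term_bound δ h0 h1 x₂ k
    calc _ ≤ (R * (1 + |(k:ℝ)|) ^ δ) *
          (P * ((1 + |x₁ - k|) ^ (-(3/2) : ℝ) + (1 + |x₂ - k|) ^ (-(3/2) : ℝ))) := by
          gcongr
          exact he j k
      _ = R * P * (((1 + |(k:ℝ)|) ^ δ * (1 + |x₁ - k|) ^ (-(3/2) : ℝ)) +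
            ((1 + |(k:ℝ)|) ^ δ * (1 + |x₂ - k|) ^ (-(3/2) : ℝ))) := by ring
      _ ≤ R * P * ((1 + |x₁|) ^ δ * qq (k - ⌊x₁⌋) + (1 + |x₂|) ^ δ * qq (k - ⌊x₂⌋)) := by
          gcongr ?_ * ?_
          exact add_le_add b1 b2
      _ = _ := by ring
  have hs1 := ((qq_shift_summable ⌊x₁⌋).hasSum).mul_left (R * P * (1 + |x₁|) ^ δ)
  have hs2 := ((qq_shift_summable ⌊x₂⌋).hasSum).mul_left (R * P * (1 + |x₂|) ^ δ)
  rw [qq_shift_tsum] at hs1 hs2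
  refine (tsum_of_norm_bounded (hs1.add hs2) hterm).trans ?_
  have c1 : (1 + |x₁|) ^ δ ≤ (1 + 2 * M) ^ δ * ((2:ℝ) ^ j) ^ δ := x_bound t₁ M ht₁ j δ h0
  have c2 : (1 + |x₂|) ^ δ ≤ (1 + 2 * M) ^ δ * ((2:ℝ) ^ j) ^ δ := x_bound t₂ M ht₂ j δ h0
  have c3 : |x₁ - x₂| ^ α ≤ 2 * (((2:ℝ) ^ j) ^ α * |t₁ - t₂| ^ α) := by
    have e2 : x₁ - x₂ = 2 * (2 ^ j * (t₁ - t₂)) := by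
      rw [hx₁, hx₂, zpow_add₀ (by norm_num), zpow_natCast, zpow_one]; ring
    rw [e2, abs_mul, abs_mul, abs_of_pos (show (0:ℝ) < 2 by norm_num),
      abs_of_pos (show (0:ℝ) < 2 ^ j by positivity), mul_rpow (by norm_num) (by positivity),
      mul_rpow (by positivity) (by positivity)]
    gcongr
    calc (2:ℝ) ^ α ≤ 2 ^ (1:ℝ) := rpow_le_rpow_of_exponent_le (by norm_num) hα1
      _ = 2 := rpow_one 2
  calc _ = R * P * (∑' k, qq k) * ((1 + |x₁|) ^ δ + (1 + |x₂|) ^ δ) := by ring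
    _ ≤ R * P * (∑' k, qq k) * ((1 + 2 * M) ^ δ * ((2:ℝ) ^ j) ^ δ +
          (1 + 2 * M) ^ δ * ((2:ℝ) ^ j) ^ δ) := by
        gcongr ?_ * ?_
        exact add_le_add c1 c2
    _ ≤ R * (200 * majC * (A + 64 * A') * (2 * (((2:ℝ) ^ j) ^ α * |t₁ - t₂| ^ α))) *
          (∑' k, qq k) * ((1 + 2 * M) ^ δ * ((2:ℝ) ^ j) ^ δ +
          (1 + 2 * M) ^ δ * ((2:ℝ) ^ j) ^ δ) := by
        rw [hP]
        gcongr
    _ = _ := by rw [hR]; ring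

lemma two_cpow_norm (j : ℕ) (z : ℂ) (hz : 0 < z.re) :
    ‖(2:ℂ) ^ (-((j : ℂ) + 1) * z)‖ ≤ ((2:ℝ) ^ j) ^ (-z.re) := by
  have e1 : ‖(2:ℂ) ^ (-((j : ℂ) + 1) * z)‖ = (2:ℝ) ^ (-((j : ℂ) + 1) * z).re := by
    have := Complex.norm_cpow_eq_rpow_re_of_pos (show (0:ℝ) < 2 by norm_num) (-((j : ℂ) + 1) * z)
    simpa using this
  rw [e1, ← rpow_natCast, ← rpow_mul (by norm_num)]
  refine rpow_le_rpow_of_exponent_le (by norm_num) ?_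
  have : (-((j : ℂ) + 1) * z).re = -((j:ℝ) + 1) * z.re := by
    simp [Complex.mul_re]
  rw [this]
  nlinarith

lemma geo_summable (γ : ℝ) (hγ : 0 < γ) : Summable (fun j : ℕ => ((2:ℝ) ^ j) ^ (-γ)) := by
  have e1 : (fun j : ℕ => ((2:ℝ) ^ j) ^ (-γ)) = fun j : ℕ => ((2:ℝ) ^ (-γ)) ^ j := by
    funext j
    rw [← rpow_natCast, ← rpow_mul (by norm_num), mul_comm, rpow_mul (by norm_num), rpow_natCast]
  rw [e1]
  exact summable_geometric_of_lt_one (rpow_nonneg (by norm_num) _)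
    (rpow_lt_one_of_one_lt_of_neg (by norm_num) (by linarith))

lemma Bc_term (η : ℝ → ℝ) (e : ℤ × ℤ → ℝ)
    (hd : Differentiable ℝ η) (A : ℝ)
    (hA : ∀ x, |η x| * (1 + |x|) ^ 6 ≤ A)
    (hm0 : ∫ x, η x = 0) (hm1 : ∫ x, x * η x = 0)
    (E δ M : ℝ) (hE : 0 ≤ E) (h0 : 0 ≤ δ) (h1 : δ ≤ 1/4)
    (he : ∀ (j : ℕ) (k : ℤ), |e ((j:ℤ) + 1, k)| ≤ E * ((2:ℝ) ^ j) ^ δ * (1 + |(k:ℝ)|) ^ δ)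
    (a' : ℝ) (ha' : 0 < a') (t : ℝ) (ht : |t| ≤ M) (j : ℕ)
    (z : ℂ) (hz : z ∈ UU a') :
    ‖(2:ℂ) ^ (-((j : ℂ) + 1) * z) * SS η e t j z‖ ≤
      E * (200 * majC * A) * (1 + 2 * M) ^ δ * (∑' k, qq k) * ((2:ℝ) ^ j) ^ (-(a' - 2 * δ)) := by
  have hA0 : 0 ≤ A := le_trans (by positivity) (hA 0)
  have hM := majC_nonneg
  have hM0 : 0 ≤ M := (abs_nonneg _).trans ht
  have hQ : 0 ≤ ∑' k, qq k := tsum_nonneg qq_nonneg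
  have hz0 : z ∈ UU 0 := ⟨ha'.trans hz.1, hz.2⟩
  have hj : (1:ℝ) ≤ 2 ^ j := one_le_pow₀ (by norm_num)
  have hjp : (0:ℝ) < 2 ^ j := by positivity
  rw [norm_mul]
  calc _ ≤ ((2:ℝ) ^ j) ^ (-a') * (E * (200 * majC * A) * (1 + 2 * M) ^ δ * (∑' k, qq k) *
      (((2:ℝ) ^ j) ^ δ * ((2:ℝ) ^ j) ^ δ)) := by
        gcongr
        · refine (two_cpow_norm j z hz0.1).trans ?_
          exact rpow_le_rpow_of_exponent_le hj (by linarith [hz.1])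
        · exact SS_bound η e hd A hA hm0 hm1 E δ M hE h0 h1 he t ht j z hz0
    _ = E * (200 * majC * A) * (1 + 2 * M) ^ δ * (∑' k, qq k) *
          (((2:ℝ) ^ j) ^ (-a') * ((2:ℝ) ^ j) ^ δ * ((2:ℝ) ^ j) ^ δ) := by ring
    _ = _ := by
        rw [← rpow_add hjp, ← rpow_add hjp]; congr 2; ring

lemma Bc_diffOn (η : ℝ → ℝ) (e : ℤ × ℤ → ℝ)
    (hd : Differentiable ℝ η) (A : ℝ)
    (hA : ∀ x, |η x| * (1 + |x|) ^ 6 ≤ A)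
    (hm0 : ∫ x, η x = 0) (hm1 : ∫ x, x * η x = 0)
    (E δ M : ℝ) (hE : 0 ≤ E) (h0 : 0 ≤ δ) (h1 : δ ≤ 1/4)
    (he : ∀ (j : ℕ) (k : ℤ), |e ((j:ℤ) + 1, k)| ≤ E * ((2:ℝ) ^ j) ^ δ * (1 + |(k:ℝ)|) ^ δ)
    (a' : ℝ) (ha' : 2 * δ < a') (t : ℝ) (ht : |t| ≤ M) :
    DifferentiableOn ℂ (Bc η e t) (UU a') := by
  have ha0 : 0 < a' := by linarith
  refine Complex.differentiableOn_tsum_of_summable_norm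
    ((geo_summable (a' - 2 * δ) (by linarith)).mul_left
      (E * (200 * majC * A) * (1 + 2 * M) ^ δ * (∑' k, qq k))) ?_ (UU_open a') ?_
  · intro j
    refine DifferentiableOn.mul ?_ ((SS_diffOn η e hd A hA hm0 hm1 E δ hE h0 h1 he t j).mono
      fun z hz => ⟨ha0.trans hz.1, hz.2⟩)
    have : Differentiable ℂ (fun z : ℂ => (2:ℂ) ^ (-((j : ℂ) + 1) * z)) := by
      intro z
      refine DifferentiableAt.const_cpow (by fun_prop) (Or.inl (by norm_num))
    exact this.differentiableOn
  · intro j z hz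
    exact Bc_term η e hd A hA hm0 hm1 E δ M hE h0 h1 he a' ha0 t ht j z hz

lemma Bc_holder (η : ℝ → ℝ) (e : ℤ × ℤ → ℝ)
    (hd : Differentiable ℝ η) (A A' : ℝ)
    (hA : ∀ x, |η x| * (1 + |x|) ^ 6 ≤ A) (hA' : ∀ x, |deriv η x| * (1 + |x|) ^ 6 ≤ A')
    (hm0 : ∫ x, η x = 0) (hm1 : ∫ x, x * η x = 0)
    (E δ M : ℝ) (hE : 0 ≤ E) (h0 : 0 ≤ δ) (h1 : δ ≤ 1/4)
    (he : ∀ (j : ℕ) (k : ℤ), |e ((j:ℤ) + 1, k)| ≤ E * ((2:ℝ) ^ j) ^ δ * (1 + |(k:ℝ)|) ^ δ)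
    (a' : ℝ) (ha' : 3 * δ ≤ a') (hδ : 0 < δ) (t₁ t₂ : ℝ) (ht₁ : |t₁| ≤ M)
    (ht₂ : |t₂| ≤ M) (z : ℂ) (hz : z ∈ UU a') :
    ‖Bc η e t₁ z - Bc η e t₂ z‖ ≤
      4 * E * (200 * majC * (A + 64 * A')) * (1 + 2 * M) ^ δ * (∑' k, qq k) *
        (∑' j : ℕ, ((2:ℝ) ^ j) ^ (-δ)) * |t₁ - t₂| ^ (z.re - 3 * δ) := by
  have hA0 : 0 ≤ A := le_trans (by positivity) (hA 0)
  have hA0' : 0 ≤ A' := le_trans (by positivity) (hA' 0)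
  have hM := majC_nonneg
  have hM0 : 0 ≤ M := (abs_nonneg _).trans ht₁
  have hQ : 0 ≤ ∑' k, qq k := tsum_nonneg qq_nonneg
  have ha0 : 0 < a' := by linarith
  have hz0 : z ∈ UU 0 := ⟨ha0.trans hz.1, hz.2⟩
  have hsum : ∀ t, |t| ≤ M → Summable (fun j : ℕ =>
      (2:ℂ) ^ (-((j : ℂ) + 1) * z) * SS η e t j z) := fun t ht =>
    Summable.of_norm_bounded ((geo_summable (a' - 2 * δ) (by linarith)).mul_left _)
      (fun j => Bc_term η e hd A hA hm0 hm1 E δ M hE h0 h1 he a' ha0 t ht j z hz)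
  have hB : ∀ t, Bc η e t z = ∑' j : ℕ, (2:ℂ) ^ (-((j : ℂ) + 1) * z) * SS η e t j z :=
    fun t => rfl
  rw [hB, hB, ← (hsum t₁ ht₁).tsum_sub (hsum t₂ ht₂)]
  set K := 4 * E * (200 * majC * (A + 64 * A')) * (1 + 2 * M) ^ δ * (∑' k, qq k) with hK
  have hK0 : 0 ≤ K := by positivity
  have hs := (geo_summable δ hδ).hasSum.mul_left (K * |t₁ - t₂| ^ (z.re - 3 * δ))
  refine (tsum_of_norm_bounded hs ?_).trans (le_of_eq (by ring))
  intro j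
  have hjp : (0:ℝ) < 2 ^ j := by positivity
  rw [← mul_sub, norm_mul]
  calc _ ≤ ((2:ℝ) ^ j) ^ (-z.re) * (K * (((2:ℝ) ^ j) ^ δ * ((2:ℝ) ^ j) ^ δ *
        ((2:ℝ) ^ j) ^ (z.re - 3 * δ) * |t₁ - t₂| ^ (z.re - 3 * δ))) := by
        gcongr
        · exact two_cpow_norm j z hz0.1
        · exact SS_holder η e hd A A' hA hA' hm0 hm1 E δ M hE h0 h1 he t₁ t₂ ht₁ ht₂ j z hz0 _
            (by linarith [hz.1]) (by linarith [hz.2.1])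
    _ = K * |t₁ - t₂| ^ (z.re - 3 * δ) * (((2:ℝ) ^ j) ^ (-z.re) * ((2:ℝ) ^ j) ^ δ *
        ((2:ℝ) ^ j) ^ δ * ((2:ℝ) ^ j) ^ (z.re - 3 * δ)) := by ring
    _ = _ := by
        rw [← rpow_add hjp, ← rpow_add hjp, ← rpow_add hjp]; congr 2; ring

/-- Uniform Hölder estimate in `t` for the `θ`-derivatives of `B̃₂`: for every `n`,
`ε > 0`, `M > 0` and `0 < a < b < 1` there is `C` such that for all `θ ∈ [a,b]` and
`t₁, t₂ ∈ [−M,M]`, `|∂_θⁿB̃₂(t₁,θ) − ∂_θⁿB̃₂(t₂,θ)| ≤ C|t₁−t₂|^{θ−ε}`. -/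
theorem Btwo_theta_deriv_holder_in_t (ψ : SchwartzMap ℝ ℝ)
    (hsupp : ∀ ξ : ℝ, (|ξ| < 2 * π / 3 ∨ 8 * π / 3 < |ξ|) → fourierT (fun x => ψ x) ξ = 0)
    (e : ℤ × ℤ → ℝ) (C₀ : ℝ)
    (hbd : ∀ j k : ℤ, |e (j, k)|
      ≤ C₀ * Real.sqrt (Real.log (2 + |(j : ℝ)|) * Real.log (2 + |(k : ℝ)|))) :
    ∀ (n : ℕ) (ε M a b : ℝ), 0 < ε → 0 < M → 0 < a → a < b → b < 1 →
      ∃ C : ℝ, ∀ θ ∈ Set.Icc a b, ∀ t₁ ∈ Set.Icc (-M) M, ∀ t₂ ∈ Set.Icc (-M) M,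
        |iteratedDerivWithin n (fun θ' => Btwo (fun x => ψ x) e t₁ θ') (Set.Ioo (0:ℝ) 1) θ
          - iteratedDerivWithin n (fun θ' => Btwo (fun x => ψ x) e t₂ θ') (Set.Ioo (0:ℝ) 1) θ|
          ≤ C * |t₁ - t₂| ^ (θ - ε) := by
  intro n ε M a b hε hM ha hab hb
  obtain ⟨A, hA⟩ := schwartz_bound ψ
  obtain ⟨A', hA'⟩ := schwartz_bound' ψ
  have hd : Differentiable ℝ (fun x => ψ x) := ψ.differentiable
  obtain ⟨hm0, hm1⟩ := moments (fun x => ψ x) hd.continuous A hA (fun ξ h => hsupp ξ (Or.inl h))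
  obtain ⟨δ, hδ, hδ1, hδ2, hδ3⟩ : ∃ δ : ℝ, 0 < δ ∧ δ ≤ 1/4 ∧ δ ≤ a / 6 ∧ δ ≤ ε / 6 :=
    ⟨min (1/4) (min (a/6) (ε/6)), by positivity, min_le_left _ _,
      (min_le_right _ _).trans (min_le_left _ _), (min_le_right _ _).trans (min_le_right _ _)⟩
  obtain ⟨r, hr, hr1, hr2, hr3, hr4⟩ :
      ∃ r : ℝ, 0 < r ∧ r ≤ ε / 2 ∧ r ≤ a / 4 ∧ r ≤ (1 - b) / 2 ∧ r ≤ 1/2 :=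
    ⟨min (ε/2) (min (a/4) (min ((1-b)/2) (1/2))), by
        have : 0 < (1 - b) / 2 := by linarith
        positivity, min_le_left _ _,
      (min_le_right _ _).trans (min_le_left _ _),
      (min_le_right _ _).trans ((min_le_right _ _).trans (min_le_left _ _)),
      (min_le_right _ _).trans ((min_le_right _ _).trans (min_le_right _ _))⟩
  obtain ⟨E, hE, he⟩ := e_bound e C₀ hbd δ hδ
  have hA0 : 0 ≤ A := le_trans (by positivity) (hA 0)
  have hA0' : 0 ≤ A' := le_trans (by positivity) (hA' 0)
  have hMC := majC_nonneg
  have hQ : 0 ≤ ∑' k, qq k := tsum_nonneg qq_nonneg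
  have hG : 0 ≤ ∑' j : ℕ, ((2:ℝ) ^ j) ^ (-δ) := tsum_nonneg fun j => rpow_nonneg (by positivity) _
  have hH := Bc_holder (fun x => ψ x) e hd A A' hA hA' hm0 hm1 E δ M hE hδ.le hδ1 he (a/2)
    (by linarith) hδ
  have hDiff := Bc_diffOn (fun x => ψ x) e hd A hA hm0 hm1 E δ M hE hδ.le hδ1 he (a/2) (by linarith)
  set K := 4 * E * (200 * majC * (A + 64 * A')) * (1 + 2 * M) ^ δ * (∑' k, qq k) *
        (∑' j : ℕ, ((2:ℝ) ^ j) ^ (-δ)) with hK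
  have hK0 : 0 ≤ K := by positivity
  refine ⟨n.factorial * (K * (1 + 2 * M) ^ (2 * ε)) / r ^ n, ?_⟩
  intro θ hθ t₁ ht₁ t₂ ht₂
  have ht₁' : |t₁| ≤ M := abs_le.2 ht₁
  have ht₂' : |t₂| ≤ M := abs_le.2 ht₂
  by_cases htt : t₁ = t₂
  · subst htt
    simp only [sub_self, abs_zero]
    have := rpow_nonneg (le_refl (0:ℝ)) (θ - ε)
    positivity
  have hpos : 0 < |t₁ - t₂| := abs_pos.2 (sub_ne_zero.2 htt)
  have hle : |t₁ - t₂| ≤ 1 + 2 * M := by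
    have := abs_sub t₁ t₂; linarith
  have hθU : (θ : ℂ) ∈ UU (a/2) := by
    refine ⟨?_, ?_, ?_⟩
    · simp only [Complex.ofReal_re]; linarith [hθ.1]
    · simp only [Complex.ofReal_re]; linarith [hθ.2]
    · simp
  have hθ01 : θ ∈ Ioo (0:ℝ) 1 := ⟨by linarith [hθ.1], by linarith [hθ.2]⟩
  have hball : Metric.closedBall (θ:ℂ) r ⊆ UU (a/2) := by
    intro z hz
    rw [mem_closedBall_iff_norm] at hz
    have hre := (Complex.abs_re_le_norm (z - θ)).trans hz
    have him := (Complex.abs_im_le_norm (z - θ)).trans hz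
    simp only [Complex.sub_re, Complex.sub_im, Complex.ofReal_re, Complex.ofReal_im, sub_zero] at hre him
    have := abs_le.1 hre
    exact ⟨by linarith [hθ.1], by linarith [hθ.2], by linarith⟩
  rw [deriv_transfer (Bc (fun x => ψ x) e t₁) _ _ (UU_open _) (hDiff t₁ ht₁')
      (fun x => Bc_ofReal _ e t₁ x) n θ hθU hθ01,
    deriv_transfer (Bc (fun x => ψ x) e t₂) _ _ (UU_open _) (hDiff t₂ ht₂')
      (fun x => Bc_ofReal _ e t₂ x) n θ hθU hθ01, ← Complex.sub_re]
  have hA1 : AnalyticAt ℂ (Bc (fun x => ψ x) e t₁) θ :=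
    (hDiff t₁ ht₁').analyticAt ((UU_open _).mem_nhds hθU)
  have hA2 : AnalyticAt ℂ (Bc (fun x => ψ x) e t₂) θ :=
    (hDiff t₂ ht₂').analyticAt ((UU_open _).mem_nhds hθU)
  rw [← iteratedDeriv_sub hA1.contDiffAt hA2.contDiffAt]
  refine (Complex.abs_re_le_norm _).trans ?_
  have hcl : DiffContOnCl ℂ (Bc (fun x => ψ x) e t₁ - Bc (fun x => ψ x) e t₂)
      (Metric.ball (θ:ℂ) r) := by
    apply DifferentiableOn.diffContOnCl
    rw [closure_ball _ hr.ne']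
    exact ((hDiff t₁ ht₁').sub (hDiff t₂ ht₂')).mono hball
  have := Complex.norm_iteratedDeriv_le_of_forall_mem_sphere_norm_le
    (C := K * (1 + 2 * M) ^ (2 * ε) * |t₁ - t₂| ^ (θ - ε)) n hr hcl ?_
  · refine this.trans (le_of_eq ?_)
    ring
  · intro z hz
    have hzU := hball (Metric.sphere_subset_closedBall hz)
    have hre : |z.re - θ| ≤ r := by
      rw [mem_sphere_iff_norm] at hz
      have := (Complex.abs_re_le_norm (z - θ)).trans hz.le
      simpa using this
    have hre' := abs_le.1 hre
    refine (hH t₁ t₂ ht₁' ht₂' z hzU).trans ?_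
    have e1 : |t₁ - t₂| ^ (z.re - 3 * δ) =
        |t₁ - t₂| ^ (ε - 3 * δ + (z.re - θ)) * |t₁ - t₂| ^ (θ - ε) := by
      rw [← rpow_add hpos]; congr 1; ring
    rw [e1, ← mul_assoc]
    clear_value K
    gcongr
    calc |t₁ - t₂| ^ (ε - 3 * δ + (z.re - θ)) ≤ (1 + 2 * M) ^ (ε - 3 * δ + (z.re - θ)) :=
          rpow_le_rpow hpos.le hle (by linarith)
      _ ≤ (1 + 2 * M) ^ (2 * ε) :=
          rpow_le_rpow_of_exponent_le (by linarith) (by linarith)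

end
end

section
/- Let ψ : ℝ → ℝ be a real-valued Schwartz function whose Fourier transform ψ̂(ξ) = ∫_ℝ e^{−iξx} ψ(x) dx vanishes outside { ξ : 2π/3 ≤ |ξ| ≤ 8π/3 } and such that { 2^{j/2} ψ(2^j · − k) : (j,k) ∈ ℤ² } is an orthonormal system in L²(ℝ). Let Ψ(y,θ) = ∫_ℝ (y−x)₊^{θ−1/2} ψ(x) dx and define Ψ̃(y,θ) = (1 / (2π Γ(θ+1/2))) ∫_ℝ e^{iyξ} e^{−i·sgn(ξ)(θ+1/2)π/2} |ξ|^{θ+1/2} ψ̂(ξ) dξ for (y,θ) ∈ ℝ × (0,1). Then: (i) Ψ̃ is real-valued, C^∞ on ℝ × (0,1), and for all nonnegative integers m, n one has sup{ (2+|y|)² |∂_y^m ∂_θ^n Ψ̃(y,θ)| : (y,θ) ∈ ℝ × (0,1) } < ∞; (ii) for all θ ∈ (0,1), ∫_ℝ Ψ̃(y,θ) dy = 0; (iii) for all θ ∈ (0,1) and all j, k, j', k' ∈ ℤ: 2^{(j+j')/2} ∫_ℝ Ψ(2^{j'} t − k', θ) Ψ̃(2^j t − k, θ) dt = 1 if (j,k)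 = (j',k') and 0 otherwise. -/
open MeasureTheory Set Real
noncomputable section
/-- The iterated partial derivative `∂_y^m ∂_θ^n F(y,θ)`, the `θ`-derivatives being
taken within `(0,1)`. -/
def pder (F : ℝ → ℝ → ℝ) (m n : ℕ) (y θ : ℝ) : ℝ :=
  iteratedDeriv m (fun y' => iteratedDerivWithin n (fun θ' => F y' θ') (Set.Ioo 0 1) θ) y

/-- The dual function
`Ψ̃(y,θ) = (2πΓ(θ+1/2))⁻¹ ∫ e^{iyξ} e^{−i sgn(ξ)(θ+1/2)π/2} |ξ|^{θ+1/2} ψ̂(ξ) dξ`. -/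
def PsiTilde (ψ : ℝ → ℝ) (y θ : ℝ) : ℂ :=
  ((1 / (2 * π * Real.Gamma (θ + 1/2)) : ℝ) : ℂ) *
    ∫ ξ : ℝ, Complex.exp (Complex.I * y * ξ)
      * Complex.exp (-(Complex.I * (Real.sign ξ : ℝ) * (θ + 1/2) * π / 2))
      * ((|ξ| ^ (θ + 1/2) : ℝ) : ℂ) * fourierT ψ ξ


open scoped ContDiff Topology


/-- Smooth weights supported in the annulus `2 ≤ |ξ| ≤ 9`. -/
def WC (w : ℝ → ℂ) : Prop :=
  ContDiff ℝ ∞ w ∧ ∀ ξ : ℝ, (|ξ| < 2 ∨ 9 < |ξ|) → w ξ = 0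

def LL (ξ : ℝ) : ℂ := Complex.log (-(Complex.I * ξ))

lemma slit_of_ne {ξ : ℝ} (h : ξ ≠ 0) : -(Complex.I * ξ) ∈ Complex.slitPlane := by
  rw [Complex.mem_slitPlane_iff]; right; simpa using h

lemma slit_of_ne' {ξ : ℝ} (h : ξ ≠ 0) : (Complex.I * ξ) ∈ Complex.slitPlane := by
  rw [Complex.mem_slitPlane_iff]; right; simpa using h

lemma LL_contDiffOn : ContDiffOn ℝ ∞ LL {0}ᶜ := by
  intro ξ hξ
  have h1 : ContDiffAt ℝ ∞ (fun ξ : ℝ => -(Complex.I * (ξ : ℂ))) ξ := by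
    have : ContDiff ℝ ∞ (fun ξ : ℝ => (ξ : ℂ)) := Complex.ofRealCLM.contDiff
    fun_prop
  have h2 : ContDiffAt ℝ ∞ Complex.log (-(Complex.I * (ξ : ℂ))) :=
    (Complex.contDiffAt_log (slit_of_ne hξ) (n := ∞)).restrict_scalars ℝ
  exact (h2.comp ξ h1).contDiffWithinAt

lemma LL_hasDerivAt {ξ : ℝ} (h : ξ ≠ 0) : HasDerivAt LL (1 / (ξ : ℂ)) ξ := by
  have h1 : HasDerivAt (fun ξ : ℝ => -(Complex.I * (ξ : ℂ))) (-(Complex.I * 1)) ξ :=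
    ((Complex.ofRealCLM.hasDerivAt (x := ξ)).const_mul Complex.I).neg
  have h2 := h1.clog_real (slit_of_ne h)
  have e : -(Complex.I * 1) / -(Complex.I * (ξ : ℂ)) = 1 / (ξ : ℂ) := by
    have : (ξ : ℂ) ≠ 0 := by exact_mod_cast h
    field_simp
  rw [e] at h2
  exact h2

lemma LL_bound {ξ : ℝ} (h1 : 2 ≤ |ξ|) (h2 : |ξ| ≤ 9) : ‖LL ξ‖ ≤ 13 := by
  have h : ‖LL ξ‖ ≤ |(LL ξ).re| + |(LL ξ).im| := Complex.norm_le_abs_re_add_abs_im _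
  have hre : (LL ξ).re = Real.log |ξ| := by simp [LL, Complex.log_re]
  have him : |(LL ξ).im| ≤ π := by simpa [LL, Complex.log_im] using Complex.abs_arg_le_pi _
  have h3 : Real.log |ξ| ≤ |ξ| - 1 := Real.log_le_sub_one_of_pos (by linarith)
  have h4 : 0 ≤ Real.log |ξ| := Real.log_nonneg (by linarith)
  rw [hre, abs_of_nonneg h4] at h
  linarith [Real.pi_lt_four]

lemma WC.hasCompactSupport {w} (h : WC w) : HasCompactSupport w := by
  refine HasCompactSupport.intro (isCompact_Icc (a := (-9 : ℝ)) (b := 9)) fun x hx => h.2 x ?_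
  right
  by_contra hc
  exact hx (abs_le.1 (not_lt.1 hc))

lemma WC.integrable {w} (h : WC w) : Integrable w :=
  h.1.continuous.integrable_of_hasCompactSupport h.hasCompactSupport

lemma WC.mul {w g} (h : WC w) (hg : ContDiffOn ℝ ∞ g {0}ᶜ) : WC (fun ξ => g ξ * w ξ) := by
  refine ⟨?_, fun ξ hξ => by simp [h.2 ξ hξ]⟩
  rw [contDiff_iff_contDiffAt]
  intro ξ
  by_cases h0 : ξ = 0
  · have : (fun ξ => g ξ * w ξ) =ᶠ[𝓝 ξ] fun _ => 0 := by
      have : {x : ℝ | |x| < 2} ∈ 𝓝 ξ :=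
        (isOpen_lt continuous_abs continuous_const).mem_nhds (by simp [h0])
      filter_upwards [this] with x hx
      simp [h.2 x (Or.inl hx)]
    exact contDiffAt_const.congr_of_eventuallyEq this
  · exact (hg.contDiffAt (isOpen_compl_singleton.mem_nhds h0)).mul h.1.contDiffAt

lemma WC.deriv {w} (h : WC w) : WC (deriv w) := by
  refine ⟨?_, fun ξ hξ => ?_⟩
  · have := h.1
    rw [show (∞ : WithTop ℕ∞) = ∞ + 1 from rfl, contDiff_succ_iff_deriv] at this
    exact this.2.2
  · have : w =ᶠ[𝓝 ξ] fun _ => 0 := by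
      have : {x : ℝ | |x| < 2 ∨ 9 < |x|} ∈ 𝓝 ξ :=
        ((isOpen_lt continuous_abs continuous_const).union
          (isOpen_lt continuous_const continuous_abs)).mem_nhds hξ
      filter_upwards [this] with x hx
      exact h.2 x hx
    rw [this.deriv_eq]; simp

lemma ofReal_smooth : ContDiff ℝ ∞ (fun ξ : ℝ => (ξ : ℂ)) := Complex.ofRealCLM.contDiff

/-- the exponential kernel -/
def EK (y θ ξ : ℝ) : ℂ := Complex.exp (Complex.I * y * ξ + (θ + 1/2) * LL ξ)

lemma EK_contDiffOn (y θ : ℝ) : ContDiffOn ℝ ∞ (EK y θ) {0}ᶜ := by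
  have h1 := LL_contDiffOn
  have h2 : ContDiffOn ℝ ∞ (fun ξ : ℝ => (ξ : ℂ)) {0}ᶜ := ofReal_smooth.contDiffOn
  unfold EK
  exact ((contDiffOn_const.mul h2).add (contDiffOn_const.mul h1)).cexp

def KK (w : ℝ → ℂ) (y θ : ℝ) : ℂ := ∫ ξ : ℝ, EK y θ ξ * w ξ

lemma WC.EK {w} (h : WC w) (y θ : ℝ) : WC (fun ξ => EK y θ ξ * w ξ) := h.mul (EK_contDiffOn y θ)

lemma WC.xi {w} (h : WC w) : WC (fun ξ => (Complex.I * ξ) * w ξ) :=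
  h.mul (contDiffOn_const.mul ofReal_smooth.contDiffOn)

lemma WC.LL {w} (h : WC w) : WC (fun ξ => LL ξ * w ξ) := h.mul LL_contDiffOn

lemma WC.inv {w} (h : WC w) : WC (fun ξ => (1 / (ξ : ℂ)) * w ξ) := by
  have h1 : ContDiffOn ℝ ∞ (fun ξ : ℝ => (ξ : ℂ)) {0}ᶜ := ofReal_smooth.contDiffOn
  have h2 : ContDiffOn ℝ ∞ (fun ξ : ℝ => 1 / (ξ : ℂ)) {0}ᶜ := by
    simp only [one_div]
    exact h1.inv (fun x hx => by simpa using hx)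
  exact h.mul h2

lemma EK_bound {w} (h : WC w) (y θ R : ℝ) (hR : |θ + 1/2| ≤ R) (ξ : ℝ) :
    ‖EK y θ ξ * w ξ‖ ≤ Real.exp (R * 13) * ‖w ξ‖ := by
  by_cases hξ : |ξ| < 2 ∨ 9 < |ξ|
  · simp [h.2 ξ hξ]
  · push Not at hξ
    rw [norm_mul]
    gcongr
    rw [_root_.EK, Complex.norm_exp]
    gcongr
    have : (Complex.I * y * ξ + (θ + 1/2) * _root_.LL ξ).re = (θ + 1/2) * (_root_.LL ξ).re := by
      have h1 : ((θ : ℂ) + 1/2) = ((θ + 1/2 : ℝ) : ℂ) := by push_cast; ring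
      rw [h1, Complex.add_re, Complex.re_ofReal_mul]
      simp
    rw [this]
    calc (θ + 1/2) * (_root_.LL ξ).re ≤ |(θ + 1/2) * (_root_.LL ξ).re| := le_abs_self _
      _ = |θ + 1/2| * |(_root_.LL ξ).re| := abs_mul _ _
      _ ≤ R * 13 := by
        gcongr
        · exact (abs_nonneg _).trans hR
        · exact (Complex.abs_re_le_norm _).trans (LL_bound hξ.1 hξ.2)

lemma KK_bound {w} (h : WC w) : ∃ C, ∀ y : ℝ, ∀ θ ∈ Set.Icc (0:ℝ) 1, ‖KK w y θ‖ ≤ C := by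
  refine ⟨∫ ξ, Real.exp (2 * 13) * ‖w ξ‖, fun y θ hθ => ?_⟩
  refine norm_integral_le_of_norm_le (h.integrable.norm.const_mul _) (.of_forall fun ξ => ?_)
  exact EK_bound h y θ 2 (by rw [abs_le]; constructor <;> linarith [hθ.1, hθ.2]) ξ

def AA : ℝ × ℝ →L[ℝ] ℂ := Complex.ofRealCLM.comp (ContinuousLinearMap.fst ℝ ℝ ℝ)
def BB : ℝ × ℝ →L[ℝ] ℂ := Complex.ofRealCLM.comp (ContinuousLinearMap.snd ℝ ℝ ℝ)

lemma KK_hasFDerivAt {w} (h : WC w) (p : ℝ × ℝ) :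
    HasFDerivAt (fun p : ℝ × ℝ => KK w p.1 p.2)
      (KK (fun ξ => (Complex.I * ξ) * w ξ) p.1 p.2 • AA +
        KK (fun ξ => LL ξ * w ξ) p.1 p.2 • BB) p := by
  have key := hasFDerivAt_integral_of_dominated_of_fderiv_le (𝕜 := ℝ) (μ := volume) (x₀ := p)
    (s := Metric.ball p 1)
    (F := fun p ξ => EK p.1 p.2 ξ * w ξ)
    (F' := fun p ξ => (EK p.1 p.2 ξ * ((Complex.I * ξ) * w ξ)) • AA +
      (EK p.1 p.2 ξ * (LL ξ * w ξ)) • BB)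
    (bound := fun ξ => Real.exp ((|p.2| + 2) * 13) * ‖(Complex.I * ξ) * w ξ‖ * ‖AA‖ +
      Real.exp ((|p.2| + 2) * 13) * ‖LL ξ * w ξ‖ * ‖BB‖)
    (Metric.ball_mem_nhds p one_pos)
    (.of_forall fun q => (h.EK q.1 q.2).1.continuous.aestronglyMeasurable)
    (h.EK p.1 p.2).integrable
    ?_ ?_ ?_ ?_
  · have e : (∫ ξ, ((EK p.1 p.2 ξ * ((Complex.I * ξ) * w ξ)) • AA +
      (EK p.1 p.2 ξ * (LL ξ * w ξ)) • BB)) = (KK (fun ξ => (Complex.I * ξ) * w ξ) p.1 p.2 • AA +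
        KK (fun ξ => LL ξ * w ξ) p.1 p.2 • BB) := by
      rw [integral_add, integral_smul_const, integral_smul_const]
      · rfl
      · exact (h.xi.EK p.1 p.2).integrable.smul_const _
      · exact (h.LL.EK p.1 p.2).integrable.smul_const _
    rw [← e]
    exact key
  · exact ((h.xi.EK p.1 p.2).integrable.smul_const AA).aestronglyMeasurable.add
      ((h.LL.EK p.1 p.2).integrable.smul_const BB).aestronglyMeasurable
  · refine .of_forall fun ξ q hq => ?_
    have hR : |q.2 + 1/2| ≤ |p.2| + 2 := by
      have h1 : |q.2 - p.2| < 1 := by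
        have := hq
        rw [Metric.mem_ball, Prod.dist_eq] at this
        exact (le_max_right _ _).trans_lt this
      have h2 : |q.2| ≤ |q.2 - p.2| + |p.2| := by simpa using abs_add_le (q.2 - p.2) p.2
      have h3 := abs_add_le q.2 (1/2)
      rw [abs_of_pos (show (0:ℝ) < 1/2 by norm_num)] at h3
      linarith
    refine (norm_add_le _ _).trans ?_
    rw [norm_smul, norm_smul]
    gcongr
    · exact EK_bound h.xi _ _ _ hR ξ
    · exact EK_bound h.LL _ _ _ hR ξ
  · exact (((h.xi.integrable.norm.const_mul _).mul_const _).add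
      ((h.LL.integrable.norm.const_mul _).mul_const _))
  · refine .of_forall fun ξ q hq => ?_
    have h1 : HasFDerivAt (fun q : ℝ × ℝ => Complex.I * q.1 * ξ + (q.2 + 1/2) * LL ξ)
        ((Complex.I * ξ) • AA + LL ξ • BB) q := by
      have hA : HasFDerivAt (fun q : ℝ × ℝ => (q.1 : ℂ)) AA q := AA.hasFDerivAt
      have hB : HasFDerivAt (fun q : ℝ × ℝ => (q.2 : ℂ)) BB q := BB.hasFDerivAt
      have := (hA.const_mul (Complex.I * ξ)).add ((hB.add_const (1/2)).mul_const (LL ξ))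
      refine this.congr_of_eventuallyEq (.of_forall fun q => ?_)
      simp only [Pi.add_apply]; ring
    have h2 := h1.cexp.mul_const (w ξ)
    refine h2.congr_fderiv ?_
    simp only [EK, smul_add, smul_smul]
    congr 2 <;> ring

lemma KK_contDiff (n : ℕ) : ∀ {w}, WC w → ContDiff ℝ n (fun p : ℝ × ℝ => KK w p.1 p.2) := by
  induction n with
  | zero =>
    intro w h
    refine contDiff_zero.2 ?_
    exact continuous_iff_continuousAt.2 fun p => (KK_hasFDerivAt h p).continuousAt
  | succ n ih =>
    intro w h
    push_cast
    rw [contDiff_succ_iff_hasFDerivAt]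
    exact ⟨_, ((ih h.xi).smul contDiff_const).add ((ih h.LL).smul contDiff_const),
      KK_hasFDerivAt h⟩

lemma KK_hasDerivAt_y {w} (h : WC w) (y θ : ℝ) :
    HasDerivAt (fun y => KK w y θ) (KK (fun ξ => (Complex.I * ξ) * w ξ) y θ) y := by
  have h1 : HasDerivAt (fun y : ℝ => (y, θ)) ((1 : ℝ), (0 : ℝ)) y :=
    (hasDerivAt_id y).prodMk (hasDerivAt_const y θ)
  have := (KK_hasFDerivAt h (y, θ)).comp_hasDerivAt y h1
  simpa [AA, BB, Function.comp_def] using! this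

lemma KK_hasDerivAt_θ {w} (h : WC w) (y θ : ℝ) :
    HasDerivAt (fun θ => KK w y θ) (KK (fun ξ => LL ξ * w ξ) y θ) θ := by
  have h1 : HasDerivAt (fun θ : ℝ => (y, θ)) ((0 : ℝ), (1 : ℝ)) θ :=
    (hasDerivAt_const θ y).prodMk (hasDerivAt_id θ)
  have := (KK_hasFDerivAt h (y, θ)).comp_hasDerivAt θ h1
  simpa [AA, BB, Function.comp_def] using! this

lemma KK_ibp {w} (h : WC w) (y θ : ℝ) :
    Complex.I * y * KK w y θ =
      -((θ + 1/2) * KK (fun ξ => (1 / (ξ : ℂ)) * w ξ) y θ + KK (deriv w) y θ) := by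
  have i1 := (h.EK y θ).integrable
  have i2 := (h.inv.EK y θ).integrable
  have i3 := (h.deriv.EK y θ).integrable
  have key := integral_eq_zero_of_hasDerivAt_of_integrable
    (f := fun ξ => EK y θ ξ * w ξ)
    (f' := fun ξ => (Complex.I * y) * (EK y θ ξ * w ξ) +
      ((θ + 1/2) * (EK y θ ξ * ((1 / (ξ : ℂ)) * w ξ)) + EK y θ ξ * deriv w ξ)) ?_
    ((i1.const_mul _).add ((i2.const_mul _).add i3)) i1
  · have i4 : Integrable (fun ξ : ℝ => ((θ : ℂ) + 1/2) * (EK y θ ξ * ((1 / (ξ : ℂ)) * w ξ)) +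
        EK y θ ξ * deriv w ξ) := (i2.const_mul _).add i3
    rw [integral_add (i1.const_mul _) i4, integral_add (i2.const_mul _) i3, integral_const_mul, integral_const_mul] at key
    exact eq_neg_of_add_eq_zero_left key
  · intro ξ
    by_cases h0 : |ξ| < 2
    · have e : (fun ξ => EK y θ ξ * w ξ) =ᶠ[𝓝 ξ] fun _ => 0 := by
        have : {x : ℝ | |x| < 2} ∈ 𝓝 ξ :=
          (isOpen_lt continuous_abs continuous_const).mem_nhds h0
        filter_upwards [this] with x hx
        simp [h.2 x (Or.inl hx)]
      simp only [h.2 ξ (Or.inl h0), h.deriv.2 ξ (Or.inl h0), mul_zero, add_zero]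
      exact (hasDerivAt_const ξ (0:ℂ)).congr_of_eventuallyEq e
    · have hne : ξ ≠ 0 := by rintro rfl; simp at h0
      have hL := LL_hasDerivAt hne
      have hid : HasDerivAt (fun ξ : ℝ => (ξ : ℂ)) 1 ξ := Complex.ofRealCLM.hasDerivAt
      have hw : HasDerivAt w (deriv w ξ) ξ :=
        (h.1.differentiable (by simp) ξ).hasDerivAt
      have := (((hid.const_mul (Complex.I * y)).add (hL.const_mul ((θ : ℂ) + 1/2))).cexp).mul hw
      refine this.congr_deriv ?_
      simp only [EK, Pi.add_apply]
      ring

lemma KK_bound1 {w} (h : WC w) :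
    ∃ C, ∀ y : ℝ, ∀ θ ∈ Set.Icc (0:ℝ) 1, ‖(y : ℂ) * KK w y θ‖ ≤ C := by
  obtain ⟨C1, h1⟩ := KK_bound h.inv
  obtain ⟨C2, h2⟩ := KK_bound h.deriv
  refine ⟨2 * C1 + C2, fun y θ hθ => ?_⟩
  have e : ‖(y : ℂ) * KK w y θ‖ = ‖Complex.I * y * KK w y θ‖ := by simp
  rw [e, KK_ibp h, norm_neg]
  refine (norm_add_le _ _).trans (add_le_add ?_ (h2 y θ hθ))
  rw [norm_mul]
  have : ‖(θ : ℂ) + 1/2‖ ≤ 2 := by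
    rw [show ((θ : ℂ) + 1/2) = ((θ + 1/2 : ℝ) : ℂ) by push_cast; ring, Complex.norm_real,
      Real.norm_eq_abs, abs_le]
    constructor <;> linarith [hθ.1, hθ.2]
  exact mul_le_mul this (h1 y θ hθ) (norm_nonneg _) (by norm_num)

lemma KK_bound2 {w} (h : WC w) :
    ∃ C, ∀ y : ℝ, ∀ θ ∈ Set.Icc (0:ℝ) 1, ‖(y : ℂ) ^ 2 * KK w y θ‖ ≤ C := by
  obtain ⟨C1, h1⟩ := KK_bound1 h.inv
  obtain ⟨C2, h2⟩ := KK_bound1 h.deriv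
  refine ⟨2 * C1 + C2, fun y θ hθ => ?_⟩
  have e : ‖(y : ℂ) ^ 2 * KK w y θ‖ = ‖y * (Complex.I * y * KK w y θ)‖ := by
    rw [pow_two, norm_mul, norm_mul, norm_mul, norm_mul, norm_mul, Complex.norm_I]; ring
  rw [e, KK_ibp h, mul_neg, norm_neg, mul_add]
  refine (norm_add_le _ _).trans (add_le_add ?_ (h2 y θ hθ))
  rw [mul_left_comm, norm_mul]
  have : ‖(θ : ℂ) + 1/2‖ ≤ 2 := by
    rw [show ((θ : ℂ) + 1/2) = ((θ + 1/2 : ℝ) : ℂ) by push_cast; ring, Complex.norm_real,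
      Real.norm_eq_abs, abs_le]
    constructor <;> linarith [hθ.1, hθ.2]
  exact mul_le_mul this (h1 y θ hθ) (norm_nonneg _) (by norm_num)

lemma KK_bound3 {w} (h : WC w) :
    ∃ C, ∀ y : ℝ, ∀ θ ∈ Set.Icc (0:ℝ) 1, (2 + |y|) ^ 2 * ‖KK w y θ‖ ≤ C := by
  obtain ⟨C0, h0⟩ := KK_bound h
  obtain ⟨C1, h1⟩ := KK_bound1 h
  obtain ⟨C2, h2⟩ := KK_bound2 h
  refine ⟨4 * C0 + 4 * C1 + C2, fun y θ hθ => ?_⟩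
  have a0 := h0 y θ hθ
  have a1 := h1 y θ hθ
  have a2 := h2 y θ hθ
  rw [norm_mul, Complex.norm_real, Real.norm_eq_abs] at a1
  rw [norm_mul, norm_pow, Complex.norm_real, Real.norm_eq_abs] at a2
  nlinarith

/-- The class of finite sums of `c(θ) K_w(y,θ)`. -/
inductive Cls : (ℝ → ℝ → ℂ) → Prop
  | base (c : ℝ → ℂ) (w : ℝ → ℂ) (hc : ContDiff ℝ ∞ c) (hw : WC w) :
      Cls (fun y θ => c θ * KK w y θ)
  | add (F G : ℝ → ℝ → ℂ) (hF : Cls F) (hG : Cls G) : Cls (fun y θ => F y θ + G y θ)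

lemma Cls.bound {F} (h : Cls F) :
    ∃ C, ∀ y : ℝ, ∀ θ ∈ Set.Icc (0:ℝ) 1, (2 + |y|) ^ 2 * ‖F y θ‖ ≤ C := by
  induction h with
  | base c w hc hw =>
    obtain ⟨C, hC⟩ := KK_bound3 hw
    obtain ⟨D, hD⟩ := (isCompact_Icc (a := (0:ℝ)) (b := 1)).exists_bound_of_continuousOn
      hc.continuous.continuousOn
    refine ⟨D * C, fun y θ hθ => ?_⟩
    rw [norm_mul, mul_left_comm]
    exact mul_le_mul (hD θ hθ) (hC y θ hθ) (by positivity) ((norm_nonneg _).trans (hD θ hθ))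
  | add F G hF hG ihF ihG =>
    obtain ⟨C, hC⟩ := ihF
    obtain ⟨D, hD⟩ := ihG
    refine ⟨C + D, fun y θ hθ => ?_⟩
    calc _ ≤ (2 + |y|) ^ 2 * (‖F y θ‖ + ‖G y θ‖) := by gcongr; exact norm_add_le _ _
      _ ≤ _ := by rw [mul_add]; exact add_le_add (hC y θ hθ) (hD y θ hθ)

lemma Cls.dy {F} (h : Cls F) :
    ∃ G, Cls G ∧ ∀ y θ, HasDerivAt (fun y => F y θ) (G y θ) y := by
  induction h with
  | base c w hc hw =>
    exact ⟨_, .base c _ hc hw.xi, fun y θ => (KK_hasDerivAt_y hw y θ).const_mul _⟩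
  | add F G hF hG ihF ihG =>
    obtain ⟨F', h1, h2⟩ := ihF
    obtain ⟨G', h3, h4⟩ := ihG
    exact ⟨_, .add _ _ h1 h3, fun y θ => (h2 y θ).add (h4 y θ)⟩

lemma Cls.dθ {F} (h : Cls F) :
    ∃ G, Cls G ∧ ∀ y θ, HasDerivAt (fun θ => F y θ) (G y θ) θ := by
  induction h with
  | base c w hc hw =>
    have hc' : ContDiff ℝ ∞ (deriv c) := by
      have := hc
      rw [show (∞ : WithTop ℕ∞) = ∞ + 1 from rfl, contDiff_succ_iff_deriv] at this
      exact this.2.2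
    exact ⟨_, .add _ _ (.base _ _ hc' hw) (.base c _ hc hw.LL), fun y θ =>
      (hc.differentiable (by simp) θ).hasDerivAt.mul (KK_hasDerivAt_θ hw y θ)⟩
  | add F G hF hG ihF ihG =>
    obtain ⟨F', h1, h2⟩ := ihF
    obtain ⟨G', h3, h4⟩ := ihG
    exact ⟨_, .add _ _ h1 h3, fun y θ => (h2 y θ).add (h4 y θ)⟩

lemma hasDerivAt_re {f : ℝ → ℂ} {f' : ℂ} {x : ℝ} (h : HasDerivAt f f' x) :
    HasDerivAt (fun x => (f x).re) f'.re x :=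
  Complex.reCLM.hasFDerivAt.comp_hasDerivAt x h

lemma Cls.iter_θ (n : ℕ) : ∀ {F}, Cls F → ∃ G, Cls G ∧ ∀ y θ,
    iteratedDeriv n (fun θ => (F y θ).re) θ = (G y θ).re := by
  induction n with
  | zero => intro F h; exact ⟨F, h, fun y θ => by simp⟩
  | succ n ih =>
    intro F h
    obtain ⟨G, hG, hd⟩ := h.dθ
    obtain ⟨H, hH, e⟩ := ih hG
    refine ⟨H, hH, fun y θ => ?_⟩
    rw [iteratedDeriv_succ', ← e]
    congr 1
    ext t
    exact (hasDerivAt_re (hd y t)).deriv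

lemma Cls.iter_y (n : ℕ) : ∀ {F}, Cls F → ∃ G, Cls G ∧ ∀ y θ,
    iteratedDeriv n (fun y => (F y θ).re) y = (G y θ).re := by
  induction n with
  | zero => intro F h; exact ⟨F, h, fun y θ => by simp⟩
  | succ n ih =>
    intro F h
    obtain ⟨G, hG, hd⟩ := h.dy
    obtain ⟨H, hH, e⟩ := ih hG
    refine ⟨H, hH, fun y θ => ?_⟩
    rw [iteratedDeriv_succ', ← e]
    congr 1
    ext t
    exact (hasDerivAt_re (hd t θ)).deriv



def EI (w : ℝ → ℂ) (y : ℝ) : ℂ := ∫ ξ : ℝ, Complex.exp (Complex.I * y * ξ) * w ξ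

open FourierTransform in
lemma EI_eq_fourierInv (w : ℝ → ℂ) (y : ℝ) : EI w y = 𝓕⁻ w (y / (2 * π)) := by
  rw [Real.fourierInv_eq']
  unfold EI
  congr 1
  ext ξ
  rw [smul_eq_mul]
  congr 2
  have : (π : ℂ) ≠ 0 := by exact_mod_cast Real.pi_ne_zero
  simp only [RCLike.inner_apply, conj_trivial]
  push_cast
  field_simp

lemma EI_scale (w : ℝ → ℂ) {α : ℝ} (hα : 0 < α) (k t : ℝ) :
    EI w (α * t - k) =
      EI (fun ξ => (α : ℂ)⁻¹ * Complex.exp (-(Complex.I * k * ξ / α)) * w (ξ / α)) t := by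
  have hα' : (α : ℂ) ≠ 0 := by exact_mod_cast hα.ne'
  have := Measure.integral_comp_div
    (fun ξ : ℝ => Complex.exp (Complex.I * ((α * t - k : ℝ) : ℂ) * ξ) * w ξ) α
  rw [abs_of_pos hα, Complex.real_smul] at this
  unfold EI
  rw [← mul_right_inj' hα', ← this, ← integral_const_mul]
  congr 1
  ext ξ
  have e : Complex.exp (Complex.I * ((α * t - k : ℝ) : ℂ) * ((ξ / α : ℝ) : ℂ)) =
      Complex.exp (Complex.I * t * ξ) * Complex.exp (-(Complex.I * k * ξ / α)) := by
    rw [← Complex.exp_add]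
    congr 1
    push_cast
    field_simp
    ring
  rw [e]
  field_simp

open FourierTransform in
lemma EI_parseval {w₁ w₂ : ℝ → ℂ} (h1 : ContDiff ℝ ∞ w₁) (c1 : HasCompactSupport w₁)
    (h2 : ContDiff ℝ ∞ w₂) (c2 : HasCompactSupport w₂) :
    ∫ t, EI w₁ t * (starRingEnd ℂ) (EI w₂ t) = 2 * π * ∫ ξ, w₁ ξ * (starRingEnd ℂ) (w₂ ξ) := by
  let W₁ := c1.toSchwartzMap h1
  let W₂ := c2.toSchwartzMap h2
  have key := SchwartzMap.integral_inner_fourier_fourier (𝓕⁻ W₂) (𝓕⁻ W₁)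
  simp only [fourier_fourierInv_eq] at key
  have k2 := SchwartzMap.integral_inner_fourier_fourier W₂ W₁
  simp_rw [EI_eq_fourierInv]
  have := Measure.integral_comp_div
    (fun ξ : ℝ => 𝓕⁻ w₁ ξ * (starRingEnd ℂ) (𝓕⁻ w₂ ξ)) (2 * π)
  rw [this, abs_of_pos Real.two_pi_pos, Complex.real_smul]
  push_cast
  congr 1
  have e1 : ∀ x, (𝓕⁻ W₁) x = 𝓕⁻ w₁ x := fun x => by rw [SchwartzMap.fourierInv_coe]; rfl
  have e2 : ∀ x, (𝓕⁻ W₂) x = 𝓕⁻ w₂ x := fun x => by rw [SchwartzMap.fourierInv_coe]; rfl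
  simp only [e1, e2, RCLike.inner_apply] at key
  exact key.symm

open FourierTransform in
lemma EI_integral {w : ℝ → ℂ} (h : ContDiff ℝ ∞ w) (c : HasCompactSupport w) :
    ∫ t, EI w t = 2 * π * w 0 := by
  let W := c.toSchwartzMap h
  simp_rw [EI_eq_fourierInv]
  rw [Measure.integral_comp_div (fun ξ : ℝ => 𝓕⁻ w ξ) (2 * π),
    abs_of_pos Real.two_pi_pos, Complex.real_smul]
  push_cast
  congr 1
  have e1 : 𝓕 (𝓕⁻ W) 0 = W 0 := by rw [fourier_fourierInv_eq]
  rw [SchwartzMap.fourier_coe, SchwartzMap.fourierInv_coe, Real.fourier_real_eq] at e1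
  simpa using! e1

/-- complexification -/
def cx (ψ : SchwartzMap ℝ ℝ) : SchwartzMap ℝ ℂ := SchwartzMap.postcompCLM Complex.ofRealCLM ψ

lemma cx_apply (ψ : SchwartzMap ℝ ℝ) (x : ℝ) : cx ψ x = ψ x := rfl

def FT (ψ : SchwartzMap ℝ ℝ) (ξ : ℝ) : ℂ :=
  ∫ x : ℝ, Complex.exp (-(Complex.I * ξ * x)) * (ψ x : ℂ)

open FourierTransform in
lemma FT_eq (ψ : SchwartzMap ℝ ℝ) (ξ : ℝ) : FT ψ ξ = 𝓕 (cx ψ) (ξ / (2 * π)) := by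
  rw [SchwartzMap.fourier_coe, Real.fourier_real_eq_integral_exp_smul]
  unfold FT
  congr 1
  ext x
  rw [smul_eq_mul, cx_apply]
  congr 2
  have : (π : ℂ) ≠ 0 := by exact_mod_cast Real.pi_ne_zero
  push_cast
  field_simp

lemma FT_contDiff (ψ : SchwartzMap ℝ ℝ) : ContDiff ℝ ∞ (FT ψ) := by
  have : FT ψ = fun ξ => FourierTransform.fourier (cx ψ) (ξ / (2 * π)) := funext (FT_eq ψ)
  rw [this]
  have h := (FourierTransform.fourier (cx ψ)).smooth ⊤
  exact h.comp (contDiff_id.div_const _)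

open FourierTransform in
lemma EI_FT (ψ : SchwartzMap ℝ ℝ) (y : ℝ) : EI (FT ψ) y = 2 * π * ψ y := by
  have h1 : (𝓕⁻ (𝓕 (cx ψ))) y = cx ψ y := by rw [fourierInv_fourier_eq]
  rw [SchwartzMap.fourierInv_coe, Real.fourierInv_eq', cx_apply] at h1
  have := Measure.integral_comp_div
    (fun v : ℝ => Complex.exp ((↑(2 * π * inner ℝ v y) * Complex.I)) • (𝓕 (cx ψ)) v) (2 * π)
  rw [h1, abs_of_pos Real.two_pi_pos, Complex.real_smul] at this
  push_cast at this
  rw [← this]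
  unfold EI
  congr 1
  ext ξ
  rw [FT_eq, smul_eq_mul]
  congr 2
  have : (π : ℂ) ≠ 0 := by exact_mod_cast Real.pi_ne_zero
  simp only [RCLike.inner_apply, conj_trivial]
  push_cast
  field_simp

lemma FT_conj (ψ : SchwartzMap ℝ ℝ) (ξ : ℝ) : (starRingEnd ℂ) (FT ψ ξ) = FT ψ (-ξ) := by
  unfold FT
  rw [← integral_conj]
  congr 1
  ext x
  rw [map_mul, ← Complex.exp_conj]
  simp

lemma norm_exp_real (r : ℂ) (t : ℝ) : ‖Complex.exp (-(r * t))‖ = Real.exp (-(r.re * t)) := by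
  rw [Complex.norm_exp]; simp

lemma gamma_integrable {a : ℝ} (ha : 0 < a) {r : ℝ} (hr : 0 < r) :
    IntegrableOn (fun t : ℝ => t ^ (a - 1) * Real.exp (-(r * t))) (Ioi 0) := by
  have := integrableOn_rpow_mul_exp_neg_mul_rpow (p := 1) (s := a - 1) (b := r) (by linarith)
    one_pos hr
  simpa using this

lemma gamma_meas {a : ℝ} (r : ℂ) : Measurable (fun t : ℝ => ((t ^ (a - 1) : ℝ) : ℂ) * Complex.exp (-(r * t))) := by
  fun_prop

lemma gamma_cintegrable {a : ℝ} (ha : 0 < a) {r : ℂ} (hr : 0 < r.re) :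
    IntegrableOn (fun t : ℝ => ((t ^ (a - 1) : ℝ) : ℂ) * Complex.exp (-(r * t))) (Ioi 0) := by
  refine (gamma_integrable ha hr).mono' (gamma_meas r).aestronglyMeasurable ?_
  refine (ae_restrict_iff' measurableSet_Ioi).2 (.of_forall fun t ht => ?_)
  rw [norm_mul, norm_exp_real, Complex.norm_real, Real.norm_of_nonneg (rpow_nonneg ht.le _)]

lemma gamma_complex {a : ℝ} (ha : 0 < a) {r : ℂ} (hr : 0 < r.re) :
    ∫ t in Ioi (0:ℝ), ((t ^ (a - 1) : ℝ) : ℂ) * Complex.exp (-(r * t)) =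
      (1 / r) ^ (a : ℂ) * Real.Gamma a := by
  let U : Set ℂ := {z | 0 < z.re}
  have hU : IsOpen U := isOpen_lt continuous_const Complex.continuous_re
  have hUc : IsPreconnected U := (convex_halfSpace_re_gt 0).isPreconnected
  have d1 : DifferentiableOn ℂ (fun r : ℂ => ∫ t in Ioi (0:ℝ),
      ((t ^ (a - 1) : ℝ) : ℂ) * Complex.exp (-(r * t))) U := by
    intro r hr
    have hr' : 0 < r.re := hr
    have hball : ∀ x ∈ Metric.ball r (r.re / 2), r.re / 2 < x.re := by
      intro x hx
      have h1 : |(x - r).re| < r.re / 2 :=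
        (Complex.abs_re_le_norm _).trans_lt (by simpa [dist_eq_norm] using hx)
      rw [Complex.sub_re, abs_lt] at h1
      linarith
    have := hasDerivAt_integral_of_dominated_loc_of_deriv_le (𝕜 := ℂ)
      (μ := volume.restrict (Ioi (0:ℝ))) (x₀ := r) (s := Metric.ball r (r.re / 2))
      (F := fun r t => ((t ^ (a - 1) : ℝ) : ℂ) * Complex.exp (-(r * t)))
      (F' := fun r t => ((t ^ (a - 1) : ℝ) : ℂ) * (Complex.exp (-(r * t)) * (-(t : ℂ))))
      (bound := fun t => t ^ ((a + 1) - 1) * Real.exp (-(r.re / 2 * t)))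
      (Metric.ball_mem_nhds r (by linarith))
      (.of_forall fun q => (gamma_meas q).aestronglyMeasurable)
      (gamma_cintegrable ha hr') (Measurable.aestronglyMeasurable (by fun_prop)) ?_
      (gamma_integrable (by linarith) (by linarith)) ?_
    · exact this.2.differentiableAt.differentiableWithinAt
    · refine (ae_restrict_iff' measurableSet_Ioi).2 (.of_forall fun t ht x hx => ?_)
      have ht' : 0 < t := ht
      rw [norm_mul, norm_mul, norm_exp_real, Complex.norm_real,
        Real.norm_of_nonneg (rpow_nonneg ht'.le _), norm_neg, Complex.norm_real,
        Real.norm_of_nonneg ht'.le, show a + 1 - 1 = (a - 1) + 1 by ring, rpow_add ht', rpow_one]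
      have : Real.exp (-(x.re * t)) ≤ Real.exp (-(r.re / 2 * t)) := by
        gcongr
        exact (hball x hx).le
      calc _ = t ^ (a - 1) * t * Real.exp (-(x.re * t)) := by ring
        _ ≤ _ := by gcongr
    · refine .of_forall fun t x hx => ?_
      have h1 : HasDerivAt (fun x : ℂ => -(x * t)) (-(t : ℂ)) x := by
        simpa using! ((hasDerivAt_id x).mul_const (t : ℂ)).neg
      exact h1.cexp.const_mul _
  have d2 : DifferentiableOn ℂ (fun r : ℂ => (1 / r) ^ (a : ℂ) * Real.Gamma a) U := by
    intro r hr
    have hr' : 0 < r.re := hr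
    have hne : r ≠ 0 := by rintro rfl; simp at hr'
    have h1 : DifferentiableAt ℂ (fun r : ℂ => 1 / r) r := by fun_prop (disch := assumption)
    have h2 : 1 / r ∈ Complex.slitPlane := by
      left
      rw [one_div, Complex.inv_re]
      exact div_pos hr' (Complex.normSq_pos.2 hne)
    exact ((h1.cpow_const h2).mul_const _).differentiableWithinAt
  have a1 := d1.analyticOnNhd hU
  have a2 := d2.analyticOnNhd hU
  have hfreq : ∃ᶠ z in 𝓝[≠] (1:ℂ), (fun r : ℂ => ∫ t in Ioi (0:ℝ),
      ((t ^ (a - 1) : ℝ) : ℂ) * Complex.exp (-(r * t))) z =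
      (fun r : ℂ => (1 / r) ^ (a : ℂ) * Real.Gamma a) z := by
    have hreal : ∀ x : ℝ, 0 < x → (∫ t in Ioi (0:ℝ),
      ((t ^ (a - 1) : ℝ) : ℂ) * Complex.exp (-((x : ℂ) * t))) =
        (1 / (x : ℂ)) ^ (a : ℂ) * Real.Gamma a := by
      intro x hx
      have := Real.integral_rpow_mul_exp_neg_mul_Ioi ha hx
      have h2 := congrArg (fun x : ℝ => (x : ℂ)) this
      rw [← integral_complex_ofReal] at h2
      push_cast at h2
      rw [Complex.ofReal_cpow (by positivity)] at h2
      push_cast at h2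
      push_cast
      exact h2
    have ht : Filter.Tendsto (fun x : ℝ => (x : ℂ)) (𝓝[≠] 1) (𝓝[≠] ((1 : ℝ) : ℂ)) := by
      refine tendsto_nhdsWithin_iff.2 ⟨(Complex.continuous_ofReal.tendsto 1).mono_left
        nhdsWithin_le_nhds, ?_⟩
      filter_upwards [self_mem_nhdsWithin] with x hx
      simpa using hx
    rw [Complex.ofReal_one] at ht
    refine ht.frequently (Filter.Eventually.frequently ?_)
    filter_upwards [nhdsWithin_le_nhds (Ioi_mem_nhds (show (0:ℝ) < 1 by norm_num))] with x hx
    exact hreal x hx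
  exact a1.eqOn_of_preconnected_of_frequently_eq a2 hUc (by simp [U]) hfreq hr



lemma psi_integrable (ψ : SchwartzMap ℝ ℝ) {a : ℝ} (ha : 0 < a) (y : ℝ) :
    IntegrableOn (fun u : ℝ => u ^ (a - 1) * ψ (y - u)) (Ioi 0) := by
  let g : SchwartzMap ℝ ℝ := SchwartzMap.compSubConstCLM ℝ y
    (SchwartzMap.compCLMOfContinuousLinearEquiv ℝ (ContinuousLinearEquiv.neg ℝ) ψ)
  have hg : ∀ u, g u = ψ (y - u) := by
    intro u
    simp [g]
  have := mellin_convergent_of_isBigO_scalar (a := a + 1) (b := 0) (s := a) (f := g)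
    (g.continuous.locallyIntegrable.locallyIntegrableOn _) ?_ (by linarith) ?_ ha
  · refine this.congr_fun (fun u _ => ?_) measurableSet_Ioi
    simp only [hg]
  · have h := (g.isBigO_cocompact_rpow (-(a + 1))).mono atTop_le_cocompact
    refine h.trans (Filter.EventuallyEq.isBigO ?_)
    filter_upwards [Filter.eventually_gt_atTop 0] with u hu
    rw [Real.norm_of_nonneg hu.le]
  · have : g =O[𝓝 0] (fun _ => (1:ℝ)) := g.continuous.continuousAt.isBigO_one ℝ
    refine (this.mono nhdsWithin_le_nhds).trans (Filter.EventuallyEq.isBigO ?_)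
    exact .of_forall fun u => by simp

lemma psi_eps (ψ : SchwartzMap ℝ ℝ) (hW : WC (FT ψ)) {a : ℝ} (ha : 0 < a) (y : ℝ) {ε : ℝ}
    (hε : 0 < ε) :
    ∫ u in Ioi (0:ℝ), ((u ^ (a - 1) * Real.exp (-(ε * u)) : ℝ) : ℂ) * (2 * π * ψ (y - u)) =
      ∫ ξ : ℝ, Complex.exp (Complex.I * y * ξ) * FT ψ ξ *
        ((1 / (ε + Complex.I * ξ)) ^ (a : ℂ) * Real.Gamma a) := by
  have hre : ∀ ξ : ℝ, 0 < ((ε : ℂ) + Complex.I * ξ).re := by intro ξ; simpa using hε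
  simp_rw [← gamma_complex ha (hre _), ← EI_FT, EI, ← integral_const_mul]
  rw [integral_integral_swap]
  · congr 1
    ext ξ
    refine setIntegral_congr_fun measurableSet_Ioi fun u _ => ?_
    have e : Complex.exp (Complex.I * ((y - u : ℝ) : ℂ) * ξ) * ((Real.exp (-(ε * u)) : ℝ) : ℂ) =
        Complex.exp (Complex.I * y * ξ) * Complex.exp (-((ε + Complex.I * ξ) * u)) := by
      rw [Complex.ofReal_exp, ← Complex.exp_add, ← Complex.exp_add]
      congr 1
      push_cast
      ring
    rw [Complex.ofReal_mul]
    linear_combination (((u ^ (a - 1) : ℝ) : ℂ) * FT ψ ξ) * e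
  · have h1 : Integrable (fun u : ℝ => ((u ^ (a - 1) * Real.exp (-(ε * u)) : ℝ) : ℂ))
        (volume.restrict (Ioi (0:ℝ))) := (gamma_integrable ha hε).ofReal
    have h2 := h1.mul_prod hW.integrable
    refine h2.mono ?_ (.of_forall fun z => ?_)
    · have hF := hW.1.continuous.measurable
      refine Measurable.aestronglyMeasurable ?_
      unfold Function.uncurry
      fun_prop
    · simp only [Function.uncurry, norm_mul]
      have : ‖Complex.exp (Complex.I * ((y - z.1 : ℝ) : ℂ) * z.2)‖ = 1 := by
        rw [Complex.norm_exp]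
        simp
      rw [this, one_mul]

lemma psi_rep (ψ : SchwartzMap ℝ ℝ) (hW : WC (FT ψ)) {a : ℝ} (ha : 0 < a) (y : ℝ) :
    2 * π * ((∫ u in Ioi (0:ℝ), u ^ (a - 1) * ψ (y - u) : ℝ) : ℂ) =
      Real.Gamma a * EI (fun ξ => Complex.exp (-(a * Complex.log (Complex.I * ξ))) * FT ψ ξ) y := by
  have t1 : Filter.Tendsto (fun ε : ℝ =>
      ∫ u in Ioi (0:ℝ), ((u ^ (a - 1) * Real.exp (-(ε * u)) : ℝ) : ℂ) * (2 * π * ψ (y - u)))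
      (𝓝[>] 0) (𝓝 (∫ u in Ioi (0:ℝ), 2 * π * ((u ^ (a - 1) * ψ (y - u) : ℝ) : ℂ))) := by
    refine tendsto_integral_filter_of_dominated_convergence
      (fun u => 2 * π * ‖u ^ (a - 1) * ψ (y - u)‖) ?_ ?_ ((psi_integrable ψ ha y).norm.const_mul _) ?_
    · refine .of_forall fun ε => Measurable.aestronglyMeasurable ?_
      have := ψ.continuous.measurable
      fun_prop
    · filter_upwards [self_mem_nhdsWithin] with ε hε
      refine (ae_restrict_iff' measurableSet_Ioi).2 (.of_forall fun u hu => ?_)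
      have hu' : 0 < u := hu
      have hε' : 0 < ε := hε
      have h1 : ‖Real.exp (-(ε * u))‖ ≤ 1 := by
        rw [Real.norm_of_nonneg (Real.exp_pos _).le]
        exact Real.exp_le_one_iff.2 (by have := mul_pos hε' hu'; linarith)
      have h2 : ‖(2 * π * ψ (y - u) : ℂ)‖ = 2 * π * ‖ψ (y - u)‖ := by
        rw [norm_mul, norm_mul, Complex.norm_real, Complex.norm_real, Real.norm_of_nonneg pi_pos.le]
        simp
      rw [norm_mul, h2, Complex.norm_real, norm_mul, norm_mul]
      calc ‖u ^ (a - 1)‖ * ‖Real.exp (-(ε * u))‖ * (2 * π * ‖ψ (y - u)‖)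
          ≤ ‖u ^ (a - 1)‖ * 1 * (2 * π * ‖ψ (y - u)‖) := by gcongr
        _ = _ := by ring
    · refine .of_forall fun u => ?_
      have h1 : Filter.Tendsto (fun ε : ℝ => ((u ^ (a - 1) * Real.exp (-(ε * u)) : ℝ) : ℂ) *
          (2 * π * ψ (y - u))) (𝓝 0) (𝓝 (((u ^ (a - 1) * Real.exp (-(0 * u)) : ℝ) : ℂ) *
          (2 * π * ψ (y - u)))) := by
        refine Continuous.tendsto (f := fun ε : ℝ => ((u ^ (a - 1) * Real.exp (-(ε * u)) : ℝ) : ℂ) *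
          (2 * π * ψ (y - u))) ?_ 0
        fun_prop
      have e : ((u ^ (a - 1) * Real.exp (-(0 * u)) : ℝ) : ℂ) * (2 * π * ψ (y - u)) =
          2 * π * ((u ^ (a - 1) * ψ (y - u) : ℝ) : ℂ) := by
        simp; ring
      rw [e] at h1
      exact h1.mono_left nhdsWithin_le_nhds
  have t2 : Filter.Tendsto (fun ε : ℝ => ∫ ξ : ℝ, Complex.exp (Complex.I * y * ξ) * FT ψ ξ *
        ((1 / (ε + Complex.I * ξ)) ^ (a : ℂ) * Real.Gamma a)) (𝓝[>] 0)
      (𝓝 (∫ ξ : ℝ, Complex.exp (Complex.I * y * ξ) * FT ψ ξ *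
        (Complex.exp (-(a * Complex.log (Complex.I * ξ))) * Real.Gamma a))) := by
    refine tendsto_integral_filter_of_dominated_convergence
      (fun ξ => ‖FT ψ ξ‖ * ‖(Real.Gamma a : ℂ)‖) ?_ ?_ (hW.integrable.norm.mul_const _) ?_
    · refine .of_forall fun ε => Measurable.aestronglyMeasurable ?_
      have := hW.1.continuous.measurable
      fun_prop
    · refine .of_forall fun ε => .of_forall fun ξ => ?_
      by_cases hξ : |ξ| < 2
      · simp [hW.2 ξ (Or.inl hξ)]
      have hn : ‖Complex.exp (Complex.I * y * ξ)‖ = 1 := by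
        rw [Complex.norm_exp]
        simp
      rw [norm_mul, norm_mul, norm_mul, hn, one_mul]
      have hle : |ξ| ≤ ‖(ε : ℂ) + Complex.I * ξ‖ := by
        have := Complex.abs_im_le_norm ((ε : ℂ) + Complex.I * ξ)
        simpa using this
      have : ‖(1 / ((ε : ℂ) + Complex.I * ξ)) ^ (a : ℂ)‖ ≤ 1 := by
        have hne : 1 / ((ε : ℂ) + Complex.I * ξ) ≠ 0 := by
          rw [one_div, ne_eq, inv_eq_zero, ← ne_eq, ← norm_pos_iff]
          push Not at hξ
          linarith
        rw [Complex.norm_cpow_of_ne_zero hne]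
        simp only [Complex.ofReal_re, Complex.ofReal_im, mul_zero, Real.exp_zero, div_one]
        refine Real.rpow_le_one (norm_nonneg _) ?_ ha.le
        rw [norm_div, norm_one]
        push Not at hξ
        exact (div_le_one (by linarith)).2 (by linarith)
      calc _ ≤ ‖FT ψ ξ‖ * (1 * ‖(Real.Gamma a : ℂ)‖) := by gcongr
        _ = _ := by ring
    · refine .of_forall fun ξ => ?_
      by_cases hξ : |ξ| < 2
      · simp [hW.2 ξ (Or.inl hξ)]
      have hne : ξ ≠ 0 := by rintro rfl; simp at hξ
      have hs := slit_of_ne' hne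
      have e : Complex.exp (-(a * Complex.log (Complex.I * ξ))) =
          (1 / (((0:ℝ) : ℂ) + Complex.I * ξ)) ^ (a : ℂ) := by
        have h0 : Complex.I * (ξ : ℂ) ≠ 0 := by simpa using hne
        rw [Complex.ofReal_zero, zero_add, one_div, Complex.cpow_def_of_ne_zero (inv_ne_zero h0),
          Complex.log_inv _ (Complex.mem_slitPlane_iff_arg.1 hs).1]
        congr 1; ring
      rw [e]
      refine Filter.Tendsto.const_mul _ (Filter.Tendsto.mul_const _ ?_)
      have hc : ContinuousAt (fun ε : ℝ => (1 / ((ε : ℂ) + Complex.I * ξ)) ^ (a : ℂ)) 0 := by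
        have hs0 : ((0:ℝ) : ℂ) + Complex.I * ξ ∈ Complex.slitPlane := by simpa using hs
        refine ContinuousAt.cpow ?_ continuousAt_const ?_
        · refine continuousAt_const.div (by fun_prop) (Complex.slitPlane_ne_zero hs0)
        · rw [one_div]
          have h0 : Complex.normSq (((0:ℝ) : ℂ) + Complex.I * ξ) ≠ 0 :=
            (Complex.normSq_pos.2 (Complex.slitPlane_ne_zero hs0)).ne'
          rw [Complex.mem_slitPlane_iff]
          right
          rw [Complex.inv_im]
          exact div_ne_zero (by simpa using hne) h0
      exact hc.tendsto.mono_left nhdsWithin_le_nhds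
  have t3 := t1.congr' (f₂ := fun ε : ℝ => ∫ ξ : ℝ, Complex.exp (Complex.I * y * ξ) * FT ψ ξ *
        ((1 / (ε + Complex.I * ξ)) ^ (a : ℂ) * Real.Gamma a)) (by
    filter_upwards [self_mem_nhdsWithin] with ε hε
    exact psi_eps ψ hW ha y hε)
  have := tendsto_nhds_unique t3 t2
  rw [integral_const_mul, integral_complex_ofReal] at this
  rw [this, EI, ← integral_const_mul]
  congr 1
  ext ξ
  ring

lemma FT_WC (ψ : SchwartzMap ℝ ℝ)
    (hsupp : ∀ ξ : ℝ, (|ξ| < 2 * π / 3 ∨ 8 * π / 3 < |ξ|) → fourierT (fun x => ψ x) ξ = 0) :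
    WC (FT ψ) := by
  refine ⟨FT_contDiff ψ, fun ξ hξ => hsupp ξ ?_⟩
  rcases hξ with h | h
  · left; linarith [Real.pi_gt_three]
  · right; linarith [Real.pi_lt_d2]

lemma LL_eq {ξ : ℝ} (h : ξ ≠ 0) :
    LL ξ = (Real.log |ξ| : ℝ) - Complex.I * (Real.sign ξ : ℝ) * π / 2 := by
  have h1 : LL ξ = (Real.log |ξ| : ℝ) + Complex.arg (-(Complex.I * ξ)) * Complex.I := by
    simp [LL, Complex.log]
  rw [h1]
  rcases lt_or_gt_of_ne h with h | h
  · have : -(Complex.I * (ξ : ℂ)) = ((-ξ : ℝ) : ℂ) * Complex.I := by push_cast; ring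
    rw [this, Complex.arg_real_mul _ (by linarith), Complex.arg_I, Real.sign_of_neg h]
    push_cast; ring
  · have : -(Complex.I * (ξ : ℂ)) = (ξ : ℂ) * (-Complex.I) := by ring
    rw [this, Complex.arg_real_mul _ h, Complex.arg_neg_I, Real.sign_of_pos h]
    push_cast; ring

lemma LL_conj {ξ : ℝ} (h : ξ ≠ 0) : (starRingEnd ℂ) (LL ξ) = LL (-ξ) := by
  unfold LL
  rw [← Complex.log_conj _ (Complex.mem_slitPlane_iff_arg.1 (slit_of_ne h)).1]
  simp

lemma LL_conj' {ξ : ℝ} (h : ξ ≠ 0) : (starRingEnd ℂ) (LL ξ) = Complex.log (Complex.I * ξ) := by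
  rw [LL_conj h]; simp [LL]

def cG (θ : ℝ) : ℂ := (1 / (2 * π)) * (Complex.Gamma ((θ : ℂ) + 1/2))⁻¹

lemma half_conj (θ : ℝ) : (starRingEnd ℂ) ((θ : ℂ) + 1/2) = (θ : ℂ) + 1/2 := by
  have : (θ : ℂ) + 1/2 = ((θ + 1/2 : ℝ) : ℂ) := by push_cast; rfl
  rw [this, Complex.conj_ofReal]

lemma cG_eq (θ : ℝ) : cG θ = ((1 / (2 * π * Real.Gamma (θ + 1/2)) : ℝ) : ℂ) := by
  unfold cG
  push_cast
  rw [← Complex.Gamma_ofReal]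
  push_cast
  simp only [one_div, mul_inv]

lemma cG_contDiff : ContDiff ℝ ∞ cG := by
  have h1 : ContDiff ℝ ∞ (fun s : ℂ => (Complex.Gamma s)⁻¹) :=
    (Complex.differentiable_one_div_Gamma.contDiff (n := ∞)).restrict_scalars ℝ
  have h2 : ContDiff ℝ ∞ (fun θ : ℝ => (θ : ℂ) + 1/2) := ofReal_smooth.add contDiff_const
  exact contDiff_const.mul (h1.comp h2)

lemma PsiTilde_eq (ψ : SchwartzMap ℝ ℝ) (hW : WC (FT ψ)) (y θ : ℝ) :
    PsiTilde (fun x => ψ x) y θ = cG θ * KK (FT ψ) y θ := by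
  rw [PsiTilde, cG_eq, KK]
  congr 2
  ext ξ
  change _ * FT ψ ξ = _
  by_cases h : ξ = 0
  · rw [hW.2 ξ (Or.inl (by simp [h]))]; simp
  · congr 1
    rw [EK, LL_eq h, Real.rpow_def_of_pos (abs_pos.2 h), Complex.ofReal_exp, ← Complex.exp_add,
      ← Complex.exp_add]
    congr 1
    push_cast
    ring

lemma KK_conj (ψ : SchwartzMap ℝ ℝ) (hW : WC (FT ψ)) (y θ : ℝ) :
    (starRingEnd ℂ) (KK (FT ψ) y θ) = KK (FT ψ) y θ := by
  unfold KK
  rw [← integral_conj, ← integral_neg_eq_self (fun ξ => EK y θ ξ * FT ψ ξ)]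
  congr 1
  ext ξ
  by_cases h : ξ = 0
  · rw [h, neg_zero, hW.2 0 (Or.inl (by simp))]; simp
  · rw [map_mul, FT_conj, EK, ← Complex.exp_conj, map_add,
      map_mul (starRingEnd ℂ) ((θ : ℂ) + 1/2), half_conj, LL_conj h, EK]
    congr 2
    simp

lemma PsiTilde_conj (ψ : SchwartzMap ℝ ℝ) (hW : WC (FT ψ)) (y θ : ℝ) :
    (starRingEnd ℂ) (PsiTilde (fun x => ψ x) y θ) = PsiTilde (fun x => ψ x) y θ := by
  rw [PsiTilde_eq ψ hW, map_mul, KK_conj ψ hW, cG_eq, Complex.conj_ofReal]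

lemma PsiTilde_re (ψ : SchwartzMap ℝ ℝ) (hW : WC (FT ψ)) (y θ : ℝ) :
    (((PsiTilde (fun x => ψ x) y θ).re : ℝ) : ℂ) = PsiTilde (fun x => ψ x) y θ :=
  Complex.conj_eq_iff_re.1 (PsiTilde_conj ψ hW y θ)

def W2 (ψ : SchwartzMap ℝ ℝ) (θ ξ : ℝ) : ℂ := EK 0 θ ξ * FT ψ ξ

def W1 (ψ : SchwartzMap ℝ ℝ) (θ ξ : ℝ) : ℂ :=
  Complex.exp (-(((θ + 1/2 : ℝ) : ℂ) * Complex.log (Complex.I * ξ))) * FT ψ ξ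

lemma W2_WC {ψ : SchwartzMap ℝ ℝ} (hW : WC (FT ψ)) (θ : ℝ) : WC (W2 ψ θ) := hW.EK 0 θ

lemma W1_WC {ψ : SchwartzMap ℝ ℝ} (hW : WC (FT ψ)) (θ : ℝ) : WC (W1 ψ θ) := by
  refine hW.mul ?_
  have h1 : ContDiffOn ℝ ∞ (fun ξ : ℝ => Complex.log (Complex.I * ξ)) {0}ᶜ := by
    intro ξ hξ
    have h1 : ContDiffAt ℝ ∞ (fun ξ : ℝ => (Complex.I * (ξ : ℂ))) ξ :=
      (contDiff_const.mul ofReal_smooth).contDiffAt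
    have h2 : ContDiffAt ℝ ∞ Complex.log ((Complex.I * (ξ : ℂ))) :=
      (Complex.contDiffAt_log (slit_of_ne' hξ) (n := ∞)).restrict_scalars ℝ
    exact (h2.comp ξ h1).contDiffWithinAt
  exact (contDiffOn_const.mul h1).neg.cexp

lemma PsiTilde_EI (ψ : SchwartzMap ℝ ℝ) (hW : WC (FT ψ)) (y θ : ℝ) :
    PsiTilde (fun x => ψ x) y θ = cG θ * EI (W2 ψ θ) y := by
  rw [PsiTilde_eq ψ hW, KK, EI]
  congr 2
  ext ξ
  rw [W2, ← mul_assoc, EK, EK, ← Complex.exp_add]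
  congr 2
  simp

lemma PsiFrac_eq (ψ : SchwartzMap ℝ ℝ) (y θ : ℝ) :
    PsiFrac (fun x => ψ x) y θ = ∫ u in Ioi (0:ℝ), u ^ ((θ + 1/2) - 1) * ψ (y - u) := by
  unfold PsiFrac
  rw [← integral_indicator measurableSet_Ioi, ← integral_sub_left_eq_self
    ((Ioi (0:ℝ)).indicator (fun u => u ^ ((θ + 1/2) - 1) * ψ (y - u))) volume y]
  congr 1
  ext x
  by_cases h : 0 < y - x
  · rw [Set.indicator_of_mem (show y - x ∈ Ioi (0:ℝ) from h), posRPow, if_pos h]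
    rw [show θ + 1/2 - 1 = θ - 1/2 by ring, sub_sub_cancel]
  · rw [Set.indicator_of_notMem (show y - x ∉ Ioi (0:ℝ) from h), posRPow, if_neg h, zero_mul]

lemma PsiFrac_EI (ψ : SchwartzMap ℝ ℝ) (hW : WC (FT ψ)) (y : ℝ) {θ : ℝ} (hθ : 0 < θ) :
    ((PsiFrac (fun x => ψ x) y θ : ℝ) : ℂ) =
      (Real.Gamma (θ + 1/2) / (2 * π)) * EI (W1 ψ θ) y := by
  have h := psi_rep ψ hW (a := θ + 1/2) (by linarith) y
  rw [← PsiFrac_eq] at h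
  have hpi : (π : ℂ) ≠ 0 := by exact_mod_cast Real.pi_ne_zero
  rw [div_mul_eq_mul_div, eq_div_iff (by simp), mul_comm, h]
  rfl

lemma EI_pair {w₁ w₂ : ℝ → ℂ} (h1 : WC w₁) (h2 : WC w₂) {α β : ℝ} (hα : 0 < α) (hβ : 0 < β)
    (k k' : ℝ) :
    ∫ t, EI w₁ (α * t - k) * (starRingEnd ℂ) (EI w₂ (β * t - k')) =
      2 * π * ∫ ξ : ℝ, ((α : ℂ)⁻¹ * Complex.exp (-(Complex.I * k * ξ / α)) * w₁ (ξ / α)) *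
        (starRingEnd ℂ) ((β : ℂ)⁻¹ * Complex.exp (-(Complex.I * k' * ξ / β)) * w₂ (ξ / β)) := by
  simp_rw [EI_scale _ hα, EI_scale _ hβ]
  have A : ∀ {w : ℝ → ℂ} (_ : WC w) {α : ℝ} (_ : 0 < α) (k : ℝ),
      ContDiff ℝ ∞ (fun ξ : ℝ => (α : ℂ)⁻¹ * Complex.exp (-(Complex.I * k * ξ / α)) * w (ξ / α)) ∧
      HasCompactSupport
        (fun ξ : ℝ => (α : ℂ)⁻¹ * Complex.exp (-(Complex.I * k * ξ / α)) * w (ξ / α)) := by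
    intro w h α hα k
    have hw : ContDiff ℝ ∞ (fun ξ : ℝ => w (ξ / α)) := h.1.comp (contDiff_id.div_const _)
    have hr := ofReal_smooth
    refine ⟨(contDiff_const.mul ((contDiff_const.mul hr).div_const _).neg.cexp).mul hw, HasCompactSupport.mul_left ?_⟩
    refine HasCompactSupport.intro (isCompact_Icc (a := (-(9 * α) : ℝ)) (b := 9 * α))
      fun x hx => h.2 _ ?_
    right
    by_contra hc
    rw [not_lt, abs_div, abs_of_pos hα, div_le_iff₀ hα] at hc
    exact hx (abs_le.1 hc)
  exact EI_parseval (A h1 hα k).1 (A h1 hα k).2 (A h2 hβ k').1 (A h2 hβ k').2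

lemma W_prod (ψ : SchwartzMap ℝ ℝ) (hW : WC (FT ψ)) (θ : ℝ) {α β : ℝ} (hα : 0 < α) (hβ : 0 < β)
    (ξ : ℝ) :
    W1 ψ θ (ξ / α) * (starRingEnd ℂ) (W2 ψ θ (ξ / β)) =
      (((α / β) ^ (θ + 1/2) : ℝ) : ℂ) * (FT ψ (ξ / α) * (starRingEnd ℂ) (FT ψ (ξ / β))) := by
  by_cases h : ξ = 0
  · have : FT ψ 0 = 0 := hW.2 0 (Or.inl (by simp))
    simp [h, W1, W2, this]
  have hb : ξ / β ≠ 0 := div_ne_zero h hβ.ne'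
  have key : ∀ γ : ℝ, 0 < γ → Complex.log (Complex.I * ((ξ / γ : ℝ) : ℂ)) =
      Complex.log (Complex.I * ξ) - (Real.log γ : ℝ) := by
    intro γ hγ
    have h0 : Complex.I * (ξ : ℂ) ≠ 0 := by simpa using h
    have := Complex.log_ofReal_mul (inv_pos.2 hγ) h0
    rw [Real.log_inv] at this
    rw [show Complex.I * ((ξ / γ : ℝ) : ℂ) = ((γ⁻¹ : ℝ) : ℂ) * (Complex.I * ξ) by push_cast; ring,
      this]
    push_cast; ring
  have e : Complex.exp (-(((θ + 1/2 : ℝ) : ℂ) * Complex.log (Complex.I * ((ξ / α : ℝ) : ℂ)))) *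
      (starRingEnd ℂ) (EK 0 θ (ξ / β)) = (((α / β) ^ (θ + 1/2) : ℝ) : ℂ) := by
    rw [EK, ← Complex.exp_conj, map_add,
      map_mul (starRingEnd ℂ) ((θ : ℂ) + 1/2), half_conj, LL_conj' hb, key α hα, key β hβ,
      Real.rpow_def_of_pos (by positivity), Complex.ofReal_exp, ← Complex.exp_add,
      Real.log_div hα.ne' hβ.ne']
    congr 1
    simp
    ring
  rw [W1, W2, map_mul, ← e]
  ring

lemma pair_psi (ψ : SchwartzMap ℝ ℝ) (hW : WC (FT ψ)) {θ : ℝ} (hθ : 0 < θ) {α β : ℝ}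
    (hα : 0 < α) (hβ : 0 < β) (k k' : ℝ) :
    ∫ t : ℝ, PsiFrac (fun x => ψ x) (α * t - k) θ * (PsiTilde (fun x => ψ x) (β * t - k') θ).re =
      (α / β) ^ (θ + 1/2) * ∫ t : ℝ, ψ (α * t - k) * ψ (β * t - k') := by
  have hpi : (π : ℂ) ≠ 0 := by exact_mod_cast Real.pi_ne_zero
  have hG : (Real.Gamma (θ + 1/2) : ℂ) ≠ 0 := by
    exact_mod_cast (Real.Gamma_pos_of_pos (by linarith)).ne'
  have hψ : ∀ x, (ψ x : ℂ) = 1 / (2 * π) * EI (FT ψ) x := by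
    intro x; rw [EI_FT]; field_simp
  have hψ' : ∀ x, (ψ x : ℂ) = 1 / (2 * π) * (starRingEnd ℂ) (EI (FT ψ) x) := by
    intro x
    have := congrArg (starRingEnd ℂ) (hψ x)
    have e : (1 / (2 * π) : ℂ) = ((1 / (2 * π) : ℝ) : ℂ) := by push_cast; rfl
    rw [Complex.conj_ofReal, map_mul, e, Complex.conj_ofReal] at this
    rw [this, e]
  have hT : ∀ y, PsiTilde (fun x => ψ x) y θ = cG θ * (starRingEnd ℂ) (EI (W2 ψ θ) y) := by
    intro y
    rw [← PsiTilde_conj ψ hW, PsiTilde_EI ψ hW, map_mul, cG_eq, Complex.conj_ofReal]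
  have hcG : cG θ = 1 / (2 * π * Real.Gamma (θ + 1/2)) := by rw [cG_eq]; push_cast; rfl
  apply Complex.ofReal_injective
  rw [Complex.ofReal_mul, ← integral_complex_ofReal, ← integral_complex_ofReal]
  have L : ∀ t : ℝ, ((PsiFrac (fun x => ψ x) (α * t - k) θ *
      (PsiTilde (fun x => ψ x) (β * t - k') θ).re : ℝ) : ℂ) =
      1 / (2 * π) ^ 2 * (EI (W1 ψ θ) (α * t - k) * (starRingEnd ℂ) (EI (W2 ψ θ) (β * t - k'))) := by
    intro t
    rw [Complex.ofReal_mul, PsiTilde_re ψ hW, PsiFrac_EI ψ hW _ hθ, hT, hcG]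
    generalize (Real.Gamma (θ + 1/2) : ℂ) = g at hG
    field_simp
  have R : ∀ t : ℝ, ((ψ (α * t - k) * ψ (β * t - k') : ℝ) : ℂ) =
      1 / (2 * π) ^ 2 * (EI (FT ψ) (α * t - k) * (starRingEnd ℂ) (EI (FT ψ) (β * t - k'))) := by
    intro t
    rw [Complex.ofReal_mul, hψ (α * t - k), hψ' (β * t - k')]
    field_simp
  simp_rw [L, R]
  rw [integral_const_mul, integral_const_mul, EI_pair (W1_WC hW θ) (W2_WC hW θ) hα hβ,
    EI_pair hW hW hα hβ]
  rw [mul_left_comm (((α / β) ^ (θ + 1/2) : ℝ) : ℂ), mul_left_comm (((α / β) ^ (θ + 1/2) : ℝ) : ℂ),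
    ← integral_const_mul (((α / β) ^ (θ + 1/2) : ℝ) : ℂ)]
  congr 3
  ext ξ
  have := W_prod ψ hW θ hα hβ ξ
  simp only [map_mul]
  linear_combination ((α : ℂ)⁻¹ * Complex.exp (-(Complex.I * k * ξ / α)) *
    ((starRingEnd ℂ) (β : ℂ)⁻¹ *
      (starRingEnd ℂ) (Complex.exp (-(Complex.I * k' * ξ / β))))) * this


/-- Properties of the dual function `Ψ̃`: (i) it is real-valued, smooth, with all
partial derivatives well-localized in `y` uniformly in `θ`; (ii) its first moment
vanishes; (iii) the systems `{2^{j/2}Ψ(2^j·−k,θ)}` and `{2^{j/2}Ψ̃(2^j·−k,θ)}` are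
biorthogonal. -/
theorem psiTilde_properties (ψ : SchwartzMap ℝ ℝ)
    (hsupp : ∀ ξ : ℝ, (|ξ| < 2 * π / 3 ∨ 8 * π / 3 < |ξ|) → fourierT (fun x => ψ x) ξ = 0)
    (horth : ∀ j k j' k' : ℤ,
      (∫ x : ℝ, ((2:ℝ) ^ ((j : ℝ) / 2) * ψ ((2:ℝ) ^ j * x - (k : ℝ)))
        * ((2:ℝ) ^ ((j' : ℝ) / 2) * ψ ((2:ℝ) ^ j' * x - (k' : ℝ))))
        = if (j, k) = (j', k') then 1 else 0) :
    -- (i)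
    ((∀ y : ℝ, ∀ θ ∈ Set.Ioo (0:ℝ) 1, (PsiTilde (fun x => ψ x) y θ).im = 0) ∧
      ContDiffOn ℝ (⊤ : ℕ∞) (fun p : ℝ × ℝ => (PsiTilde (fun x => ψ x) p.1 p.2).re)
        (Set.univ ×ˢ Set.Ioo (0:ℝ) 1) ∧
      ∀ m n : ℕ, ∃ C : ℝ, ∀ y : ℝ, ∀ θ ∈ Set.Ioo (0:ℝ) 1,
        (2 + |y|) ^ 2
          * |pder (fun y' θ' => (PsiTilde (fun x => ψ x) y' θ').re) m n y θ| ≤ C) ∧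
    -- (ii)
    (∀ θ ∈ Set.Ioo (0:ℝ) 1, (∫ y : ℝ, (PsiTilde (fun x => ψ x) y θ).re) = 0) ∧
    -- (iii)
    (∀ θ ∈ Set.Ioo (0:ℝ) 1, ∀ j k j' k' : ℤ,
      (2:ℝ) ^ (((j : ℝ) + (j' : ℝ)) / 2)
        * (∫ t : ℝ, PsiFrac (fun x => ψ x) ((2:ℝ) ^ j' * t - (k' : ℝ)) θ
            * (PsiTilde (fun x => ψ x) ((2:ℝ) ^ j * t - (k : ℝ)) θ).re)
        = if (j, k) = (j', k') then 1 else 0) := by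
  have hW := FT_WC ψ hsupp
  refine ⟨⟨fun y θ _ => ?_, ?_, fun m n => ?_⟩, fun θ hθ => ?_, fun θ hθ j k j' k' => ?_⟩
  · exact Complex.conj_eq_iff_im.1 (PsiTilde_conj ψ hW y θ)
  · refine ContDiff.contDiffOn ?_
    simp_rw [PsiTilde_eq ψ hW]
    have h1 : ContDiff ℝ ∞ (fun p : ℝ × ℝ => KK (FT ψ) p.1 p.2) :=
      contDiff_infty.2 fun n => KK_contDiff n hW
    have h2 : ContDiff ℝ ∞ (fun p : ℝ × ℝ => cG p.2) := cG_contDiff.comp contDiff_snd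
    exact Complex.reCLM.contDiff.comp (h2.mul h1)
  · have hF : Cls (fun y θ => cG θ * KK (FT ψ) y θ) := .base _ _ cG_contDiff hW
    obtain ⟨G, hG, eG⟩ := Cls.iter_θ n hF
    obtain ⟨H, hH, eH⟩ := Cls.iter_y m hG
    obtain ⟨C, hC⟩ := hH.bound
    refine ⟨C, fun y θ hθ => ?_⟩
    have e : pder (fun y' θ' => (PsiTilde (fun x => ψ x) y' θ').re) m n y θ = (H y θ).re := by
      unfold pder
      rw [← eH]
      congr 1
      ext y'
      rw [iteratedDerivWithin_of_isOpen isOpen_Ioo hθ, ← eG]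
      simp_rw [PsiTilde_eq ψ hW]
    rw [e]
    refine le_trans ?_ (hC y θ ⟨hθ.1.le, hθ.2.le⟩)
    gcongr
    exact Complex.abs_re_le_norm _
  · apply Complex.ofReal_injective
    rw [← integral_complex_ofReal]
    simp_rw [PsiTilde_re ψ hW, PsiTilde_EI ψ hW]
    rw [integral_const_mul, EI_integral (W2_WC hW θ).1 (W2_WC hW θ).hasCompactSupport,
      (W2_WC hW θ).2 0 (Or.inl (by simp))]
    simp
  · rw [pair_psi ψ hW hθ.1 (by positivity) (by positivity)]
    have h := horth j' k' j k
    have e : ∀ x : ℝ, ((2:ℝ) ^ ((j' : ℝ) / 2) * ψ ((2:ℝ) ^ j' * x - (k' : ℝ)))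
        * ((2:ℝ) ^ ((j : ℝ) / 2) * ψ ((2:ℝ) ^ j * x - (k : ℝ))) =
        (2:ℝ) ^ (((j : ℝ) + (j' : ℝ)) / 2) *
          (ψ ((2:ℝ) ^ j' * x - (k' : ℝ)) * ψ ((2:ℝ) ^ j * x - (k : ℝ))) := by
      intro x
      rw [add_div, Real.rpow_add two_pos]
      ring
    simp_rw [e] at h
    rw [integral_const_mul] at h
    rw [mul_left_comm, h]
    by_cases hjk : (j, k) = (j', k')
    · obtain ⟨rfl, rfl⟩ := Prod.mk.inj hjk
      simp [div_self (zpow_ne_zero j (two_ne_zero (α := ℝ)))]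
    · rw [if_neg hjk, if_neg (fun h => hjk h.symm), mul_zero]

end
end
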